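/- Let d ≥ 1 and let Ω ⊆ ℝ^d be an open set. There is a constant C depending only on d such that for every f ∈ L¹_{~loc}(Ω) with var_Ω f < ∞, the interior dyadic local maximal function M̃_Ω f belongs to L¹_{~loc}(Ω) and var_Ω (M̃_Ω f) ≤ C · var_Ω f. -/

import Mathlib

open MeasureTheory Metric Set Filter
open scoped ENNReal Topology

noncomputable section

/-- `ℝ^d` as Euclidean space. -/
abbrev Ed (d : ℕ) := EuclideanSpace ℝ (Fin d)

/-- A dyadic cube `∏_i [2^n m_i, 2^n (m_i + 1))`. -/
def IsDyadicCube {d : ℕ} (Q : Set (Ed d)) : Prop :=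
  ∃ (n : ℤ) (m : Fin d → ℤ),
    Q = {x : Ed d | ∀ i, x i ∈ Set.Ico ((2:ℝ)^n * m i) ((2:ℝ)^n * (m i + 1))}

/-- Divergence of a vector field `φ : ℝ^d → ℝ^d`. -/
def divergence {d : ℕ} (φ : Ed d → Ed d) (x : Ed d) : ℝ :=
  ∑ i, fderiv ℝ φ x (EuclideanSpace.single i 1) i

/-- The variation of `f` in `Ω`. -/
def var {d : ℕ} (Ω : Set (Ed d)) (f : Ed d → ℝ) : ℝ≥0∞ :=
  ⨆ φ ∈ {φ : Ed d → Ed d | ContDiff ℝ 1 φ ∧ HasCompactSupport φ ∧ tsupport φ ⊆ Ω ∧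
      ∀ x, ‖φ x‖ ≤ 1},
    ENNReal.ofReal (∫ x in Ω, f x * divergence φ x)

/-- `f ∈ L¹_{~loc}(Ω)`: `f` is integrable on every bounded measurable subset of `Ω`. -/
def MemL1TildeLoc {d : ℕ} (Ω : Set (Ed d)) (f : Ed d → ℝ) : Prop :=
  ∀ U : Set (Ed d), U ⊆ Ω → Bornology.IsBounded U → MeasurableSet U → IntegrableOn f U volume

/-- The interior dyadic local maximal function
`M̃_Ω f(x) = sup { ⨍_Q f : Q dyadic cube, x ∈ Q, interior Q ⊆ Ω }`. -/
def dyadicMaxFunInt {d : ℕ} (Ω : Set (Ed d)) (f : Ed d → ℝ) (x : Ed d) : ℝ :=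
  sSup {y : ℝ | ∃ Q : Set (Ed d), IsDyadicCube Q ∧ x ∈ Q ∧ interior Q ⊆ Ω ∧ y = ⨍ z in Q, f z}

namespace DyadicGrid

section

variable {d : ℕ}

/-- The cells of the dyadic cube of generation `k` in `ℤ^d` which contains the cell `x`. -/
def cube (k : ℕ) (x : Fin d → ℤ) : Finset (Fin d → ℤ) :=
  Fintype.piFinset fun i => Finset.Ico (2 ^ k * (x i / 2 ^ k)) (2 ^ k * (x i / 2 ^ k) + 2 ^ k)

lemma ediv_eq_iff_mem_Ico {b y q : ℤ} (hb : 0 < b) : y / b = q ↔ b * q ≤ y ∧ y < b * q + b := by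
  constructor
  · rintro rfl
    exact ⟨Int.mul_ediv_self_le hb.ne', Int.lt_mul_ediv_self_add hb⟩
  · rintro ⟨h1, h2⟩
    apply le_antisymm
    · apply Int.lt_add_one_iff.1
      apply Int.ediv_lt_of_lt_mul hb
      linarith
    · apply Int.le_ediv_of_mul_le hb
      linarith

lemma mem_cube {k : ℕ} {x y : Fin d → ℤ} : y ∈ cube k x ↔ ∀ i, y i / 2 ^ k = x i / 2 ^ k := by
  simp only [cube, Fintype.mem_piFinset, Finset.mem_Ico]
  exact forall_congr' fun i => (ediv_eq_iff_mem_Ico (by positivity)).symm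

lemma self_mem_cube (k : ℕ) (x : Fin d → ℤ) : x ∈ cube k x := mem_cube.2 fun _ => rfl

lemma mem_cube_comm {k : ℕ} {x y : Fin d → ℤ} : y ∈ cube k x ↔ x ∈ cube k y := by
  simp only [mem_cube, eq_comm]

lemma cube_eq_of_mem {k : ℕ} {x y : Fin d → ℤ} (h : y ∈ cube k x) : cube k y = cube k x := by
  ext z
  rw [mem_cube] at *
  rw [mem_cube]
  simp only [h]

lemma mem_cube_mono {j k : ℕ} (hjk : j ≤ k) {x y : Fin d → ℤ} (h : y ∈ cube j x) :
    y ∈ cube k x := by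
  rw [mem_cube] at *
  intro i
  obtain ⟨m, rfl⟩ := Nat.exists_eq_add_of_le hjk
  rw [pow_add, ← Int.ediv_ediv_of_nonneg (by positivity), ← Int.ediv_ediv_of_nonneg (by positivity),
    h i]

lemma cube_subset_cube {j k : ℕ} (hjk : j ≤ k) (x : Fin d → ℤ) : cube j x ⊆ cube k x :=
  fun _ h => mem_cube_mono hjk h

lemma card_cube (k : ℕ) (x : Fin d → ℤ) : (cube k x).card = (2 ^ k) ^ d := by
  have h : ((2 : ℤ) ^ k).toNat = 2 ^ k := by
    rw [show ((2 : ℤ) ^ k) = ((2 ^ k : ℕ) : ℤ) by push_cast; rfl, Int.toNat_natCast]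
  rw [cube, Fintype.card_piFinset]
  simp [h]

lemma cube_zero (x : Fin d → ℤ) : cube 0 x = {x} := by
  ext y
  simp [mem_cube, funext_iff]

/-- The average of `g` over the dyadic cube of generation `k` around `x`. -/
def avg (k : ℕ) (g : (Fin d → ℤ) → ℝ) (x : Fin d → ℤ) : ℝ :=
  (∑ y ∈ cube k x, g y) / (2 ^ k) ^ d

lemma avg_eq_of_mem {k : ℕ} {x y : Fin d → ℤ} (g : (Fin d → ℤ) → ℝ) (h : y ∈ cube k x) :
    avg k g y = avg k g x := by
  rw [avg, avg, cube_eq_of_mem h]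

lemma avg_zero (g : (Fin d → ℤ) → ℝ) (x : Fin d → ℤ) : avg 0 g x = g x := by
  simp [avg, cube_zero]

lemma avg_mono {k : ℕ} {g h : (Fin d → ℤ) → ℝ} {x : Fin d → ℤ}
    (hgh : ∀ y ∈ cube k x, g y ≤ h y) : avg k g x ≤ avg k h x := by
  unfold avg
  gcongr with y hy
  exact hgh y hy

lemma sum_cube_eq (k : ℕ) (g : (Fin d → ℤ) → ℝ) (x : Fin d → ℤ) :
    ∑ y ∈ cube k x, g y = (2 ^ k) ^ d * avg k g x := by
  unfold avg
  field_simp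

lemma avg_const (k : ℕ) (c : ℝ) (x : Fin d → ℤ) : avg k (fun _ => c) x = c := by
  simp only [avg, Finset.sum_const, card_cube, nsmul_eq_mul]
  push_cast
  field_simp

lemma avg_add (k : ℕ) (g h : (Fin d → ℤ) → ℝ) (x : Fin d → ℤ) :
    avg k (fun y => g y + h y) x = avg k g x + avg k h x := by
  simp only [avg, Finset.sum_add_distrib, add_div]

lemma avg_mul_left (k : ℕ) (c : ℝ) (g : (Fin d → ℤ) → ℝ) (x : Fin d → ℤ) :
    avg k (fun y => c * g y) x = c * avg k g x := by
  simp only [avg, ← Finset.mul_sum, mul_div_assoc]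

lemma avg_neg (k : ℕ) (g : (Fin d → ℤ) → ℝ) (x : Fin d → ℤ) :
    avg k (fun y => -g y) x = -avg k g x := by
  simp only [avg, Finset.sum_neg_distrib, neg_div]

lemma avg_sum {ι : Type*} (k : ℕ) (s : Finset ι) (g : ι → (Fin d → ℤ) → ℝ) (x : Fin d → ℤ) :
    avg k (fun y => ∑ i ∈ s, g i y) x = ∑ i ∈ s, avg k (g i) x := by
  simp only [avg]
  rw [Finset.sum_comm, Finset.sum_div]

lemma avg_nonneg {k : ℕ} {g : (Fin d → ℤ) → ℝ} {x : Fin d → ℤ}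
    (hg : ∀ y ∈ cube k x, 0 ≤ g y) : 0 ≤ avg k g x :=
  div_nonneg (Finset.sum_nonneg hg) (by positivity)

/-- Averaging over cubes does not change the integral against functions which are constant
on cubes. -/
lemma sum_mul_avg {k : ℕ} {S : Finset (Fin d → ℤ)} (hS : ∀ x ∈ S, ∀ y ∈ cube k x, y ∈ S)
    {w : (Fin d → ℤ) → ℝ} (hw : ∀ x ∈ S, ∀ y ∈ cube k x, w y = w x) (g : (Fin d → ℤ) → ℝ) :
    ∑ x ∈ S, w x * avg k g x = ∑ x ∈ S, w x * g x := by
  have h1 : ∀ x ∈ S, w x * avg k g x = ∑ y ∈ cube k x, w y * g y / (2 ^ k) ^ d := by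
    intro x hx
    rw [avg, Finset.sum_div, Finset.mul_sum]
    refine Finset.sum_congr rfl fun y hy => ?_
    rw [hw x hx y hy, mul_div_assoc]
  rw [Finset.sum_congr rfl h1, Finset.sum_comm' (t' := S) (s' := fun y => cube k y)]
  · refine Finset.sum_congr rfl fun y _ => ?_
    rw [Finset.sum_const, card_cube, nsmul_eq_mul]
    push_cast
    field_simp
  · intro x y
    constructor
    · rintro ⟨h, h'⟩
      exact ⟨mem_cube_comm.1 h', hS x h y h'⟩
    · rintro ⟨h, h'⟩
      exact ⟨hS y h' x h, mem_cube_comm.1 h⟩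

/-- The neighbour of the cell `x` in direction `±e_i`. -/
def nb (x : Fin d → ℤ) (j : Fin d × Bool) : Fin d → ℤ :=
  Function.update x j.1 (x j.1 + if j.2 then 1 else -1)

/-- Sum of the decrements of `g` along the edges of the cube of generation `k` around `w`
emanating from the cell `t` in direction `i`. -/
def decr (k : ℕ) (w : Fin d → ℤ) (g : (Fin d → ℤ) → ℝ) (i : Fin d) (t : Fin d → ℤ) : ℝ :=
  ∑ b : Bool, if nb t (i, b) ∈ cube k w then max (g t - g (nb t (i, b))) 0 else 0

lemma decr_nonneg (k : ℕ) (w : Fin d → ℤ) (g : (Fin d → ℤ) → ℝ) (i : Fin d) (t : Fin d → ℤ) :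
    0 ≤ decr k w g i t :=
  Finset.sum_nonneg fun b _ => by split_ifs <;> simp

lemma le_decr {k : ℕ} {w : Fin d → ℤ} (g : (Fin d → ℤ) → ℝ) {i : Fin d} {t : Fin d → ℤ} (b : Bool)
    (h : nb t (i, b) ∈ cube k w) : g t - g (nb t (i, b)) ≤ decr k w g i t := by
  refine (le_max_left _ 0).trans ?_
  have := Finset.single_le_sum (f := fun b : Bool => if nb t (i, b) ∈ cube k w then
    max (g t - g (nb t (i, b))) 0 else 0) (s := Finset.univ)
    (fun b _ => by split_ifs <;> simp) (Finset.mem_univ b)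
  rw [if_pos h] at this
  exact this

/-- The side of the cube of generation `k` around `w` in direction `i`. -/
def side (k : ℕ) (w : Fin d → ℤ) (i : Fin d) : Finset ℤ :=
  Finset.Ico (2 ^ k * (w i / 2 ^ k)) (2 ^ k * (w i / 2 ^ k) + 2 ^ k)

lemma card_side (k : ℕ) (w : Fin d → ℤ) (i : Fin d) : (side k w i).card = 2 ^ k := by
  have h : ((2 : ℤ) ^ k).toNat = 2 ^ k := by
    rw [show ((2 : ℤ) ^ k) = ((2 ^ k : ℕ) : ℤ) by push_cast; rfl, Int.toNat_natCast]
  simp [side, h]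

/-- Telescoping along a line in a cube. -/
lemma sub_update_le {k : ℕ} {w : Fin d → ℤ} (g : (Fin d → ℤ) → ℝ) {i : Fin d} {z : Fin d → ℤ}
    (hz : z ∈ cube k w) {s : ℤ} (hs : s ∈ side k w i) :
    g z - g (Function.update z i s) ≤
      ∑ t ∈ side k w i, decr k w g i (Function.update z i t) := by
  have hmem : ∀ t ∈ side k w i, Function.update z i t ∈ cube k w := by
    intro t ht
    refine Fintype.mem_piFinset.2 fun l => ?_
    by_cases hl : l = i
    · subst hl; simpa [side] using ht
    · rw [Function.update_of_ne hl]; exact Fintype.mem_piFinset.1 hz l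
  have hzi : z i ∈ side k w i := Fintype.mem_piFinset.1 hz i
  have hI : ∀ p q t, p ∈ side k w i → q ∈ side k w i → p ≤ t → t ≤ q → t ∈ side k w i := by
    intro p q t hp hq h1 h2
    simp only [side, Finset.mem_Ico] at *
    exact ⟨hp.1.trans h1, h2.trans_lt hq.2⟩
  -- steps in the positive direction
  have up : ∀ n : ℕ, ∀ p ∈ side k w i, p + n ∈ side k w i →
      g (Function.update z i p) - g (Function.update z i (p + n)) ≤
        ∑ t ∈ Finset.Ico p (p + n), decr k w g i (Function.update z i t) := by
    intro n
    induction n with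
    | zero => intro p _ _; simp
    | succ n ih =>
      intro p hp hq
      have hm : p + n ∈ side k w i := hI _ _ _ hp hq (by omega) (by push_cast; omega)
      have h1 := ih p hp hm
      have h2 : nb (Function.update z i (p + n)) (i, true) =
          Function.update z i (p + (n + 1 : ℕ)) := by
        simp [nb, add_assoc]
      have h3 := le_decr (k := k) (w := w) g (i := i) (t := Function.update z i (p + n)) true
        (by rw [h2]; exact hmem _ hq)
      rw [h2] at h3
      have h4 : Finset.Ico p (p + ((n + 1 : ℕ) : ℤ)) = insert (p + n) (Finset.Ico p (p + n)) := by
        ext t; simp only [Finset.mem_Ico, Finset.mem_insert]; push_cast; omega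
      rw [h4, Finset.sum_insert (by simp)]
      linarith
  have down : ∀ n : ℕ, ∀ p ∈ side k w i, p - n ∈ side k w i →
      g (Function.update z i p) - g (Function.update z i (p - n)) ≤
        ∑ t ∈ Finset.Ioc (p - n) p, decr k w g i (Function.update z i t) := by
    intro n
    induction n with
    | zero => intro p _ _; simp
    | succ n ih =>
      intro p hp hq
      have hm : p - n ∈ side k w i := hI _ _ _ hq hp (by push_cast; omega) (by omega)
      have h1 := ih p hp hm
      have h2 : nb (Function.update z i (p - n)) (i, false) =
          Function.update z i (p - (n + 1 : ℕ)) := by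
        simp [nb]; ring_nf
      have h3 := le_decr (k := k) (w := w) g (i := i) (t := Function.update z i (p - n)) false
        (by rw [h2]; exact hmem _ hq)
      rw [h2] at h3
      have h4 : Finset.Ioc (p - ((n + 1 : ℕ) : ℤ)) p = insert (p - n) (Finset.Ioc (p - n) p) := by
        ext t; simp only [Finset.mem_Ioc, Finset.mem_insert]; push_cast; omega
      rw [h4, Finset.sum_insert (by simp)]
      linarith
  rcases le_total (z i) s with h | h
  · obtain ⟨n, hn⟩ := Int.eq_ofNat_of_zero_le (sub_nonneg.2 h)
    obtain rfl : s = z i + n := by linarith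
    have h1 := up n (z i) hzi hs
    rw [Function.update_eq_self] at h1
    refine h1.trans (Finset.sum_le_sum_of_subset_of_nonneg ?_ fun _ _ _ => decr_nonneg _ _ _ _ _)
    intro t ht
    rw [Finset.mem_Ico] at ht
    exact hI _ _ _ hzi hs ht.1 ht.2.le
  · obtain ⟨n, hn⟩ := Int.eq_ofNat_of_zero_le (sub_nonneg.2 h)
    obtain rfl : s = z i - n := by linarith
    have h1 := down n (z i) hzi hs
    rw [Function.update_eq_self] at h1
    refine h1.trans (Finset.sum_le_sum_of_subset_of_nonneg ?_ fun _ _ _ => decr_nonneg _ _ _ _ _)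
    intro t ht
    rw [Finset.mem_Ioc] at ht
    exact hI _ _ _ hs hzi ht.1.le ht.2

end

section

variable {d : ℕ}

lemma sum_le_sum_of_injOn' {α β : Type*} [DecidableEq β] {s : Finset α} {t : Finset β} {F : β → ℝ}
    (e : α → β) (he : ∀ a ∈ s, e a ∈ t) (hinj : Set.InjOn e s) (hF : ∀ b ∈ t, 0 ≤ F b) :
    ∑ a ∈ s, F (e a) ≤ ∑ b ∈ t, F b := by
  rw [← Finset.sum_image hinj]
  refine Finset.sum_le_sum_of_subset_of_nonneg ?_ fun b hb _ => hF b hb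
  intro b hb
  obtain ⟨a, ha, rfl⟩ := Finset.mem_image.1 hb
  exact he a ha

lemma sum_decr_hybrid_le {k₁ k₂ : ℕ} (hk : k₁ ≤ k₂) (w : Fin d → ℤ) (g : (Fin d → ℤ) → ℝ)
    (j : Fin d) :
    ∑ x ∈ cube k₁ w, ∑ y ∈ cube k₂ w, ∑ t ∈ side k₂ w j, decr k₂ w g j
        (Function.update (fun i : Fin d => if i < j then y i else x i) j t) ≤
      2 ^ k₁ * ((2 ^ k₂) ^ d * ∑ u ∈ cube k₂ w, decr k₂ w g j u) := by
  have h1 : ∑ p ∈ cube k₁ w ×ˢ cube k₂ w ×ˢ side k₂ w j, decr k₂ w g j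
      (Function.update (fun i : Fin d => if i < j then p.2.1 i else p.1 i) j p.2.2) ≤
      ∑ q ∈ cube k₂ w ×ˢ cube k₂ w ×ˢ side k₁ w j, decr k₂ w g j q.1 := by
    have inj := @sum_le_sum_of_injOn' _ _ _ (cube k₁ w ×ˢ cube k₂ w ×ˢ side k₂ w j)
      (cube k₂ w ×ˢ cube k₂ w ×ˢ side k₁ w j)
      (fun q : (Fin d → ℤ) × (Fin d → ℤ) × ℤ => decr k₂ w g j q.1)
      (fun p : (Fin d → ℤ) × (Fin d → ℤ) × ℤ =>
        (Function.update (fun i : Fin d => if i < j then p.2.1 i else p.1 i) j p.2.2,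
          (fun i : Fin d => if i < j then p.1 i else p.2.1 i), p.1 j))
    refine inj ?_ ?_ fun q _ => decr_nonneg _ _ _ _ _
    · rintro ⟨x, y, t⟩ hp
      simp only [Finset.mem_product] at hp ⊢
      obtain ⟨hx, hy, ht⟩ := hp
      have hx2 := mem_cube_mono hk hx
      refine ⟨?_, ?_, ?_⟩
      · refine Fintype.mem_piFinset.2 fun i => ?_
        by_cases hi : i = j
        · subst hi; simpa [side] using ht
        · rw [Function.update_of_ne hi]
          split_ifs
          · exact Fintype.mem_piFinset.1 hy i
          · exact Fintype.mem_piFinset.1 hx2 i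
      · refine Fintype.mem_piFinset.2 fun i => ?_
        split_ifs
        · exact Fintype.mem_piFinset.1 hx2 i
        · exact Fintype.mem_piFinset.1 hy i
      · exact Fintype.mem_piFinset.1 hx j
    · rintro ⟨x, y, t⟩ _ ⟨x', y', t'⟩ _ h
      simp only [Prod.mk.injEq] at h
      obtain ⟨h1, h2, h3⟩ := h
      have ht : t = t' := by simpa using congrFun h1 j
      have hxy : ∀ i, x i = x' i ∧ y i = y' i := by
        intro i
        have e1 := congrFun h1 i
        have e2 := congrFun h2 i
        rcases lt_trichotomy i j with hi | hi | hi
        · simp only [Function.update_of_ne hi.ne, if_pos hi] at e1 e2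
          exact ⟨e2, e1⟩
        · subst hi
          simp only [lt_irrefl, if_false] at e2
          exact ⟨h3, e2⟩
        · simp only [Function.update_of_ne hi.ne', if_neg hi.not_gt] at e1 e2
          exact ⟨e1, e2⟩
      simp only [Prod.mk.injEq]
      exact ⟨funext fun i => (hxy i).1, funext fun i => (hxy i).2, ht⟩
  simp only [Finset.sum_product] at h1
  refine h1.trans (le_of_eq ?_)
  simp only [Finset.sum_const, card_cube, card_side, nsmul_eq_mul, Finset.mul_sum]
  push_cast
  refine Finset.sum_congr rfl fun u _ => ?_
  ring

/-- A discrete Poincaré inequality on pairs of nested cubes. -/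
lemma sum_sum_sub_le {k₁ k₂ : ℕ} (hk : k₁ ≤ k₂) (w : Fin d → ℤ) (g : (Fin d → ℤ) → ℝ) :
    ∑ x ∈ cube k₁ w, ∑ y ∈ cube k₂ w, max (g x - g y) 0 ≤
      2 ^ k₁ * ((2 ^ k₂) ^ d * ∑ u ∈ cube k₂ w, ∑ j, decr k₂ w g j u) := by
  have key : ∀ x ∈ cube k₁ w, ∀ y ∈ cube k₂ w, max (g x - g y) 0 ≤
      ∑ j : Fin d, ∑ t ∈ side k₂ w j, decr k₂ w g j
        (Function.update (fun i : Fin d => if i < j then y i else x i) j t) := by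
    intro x hx y hy
    refine max_le ?_ (Finset.sum_nonneg fun j _ => Finset.sum_nonneg fun t _ => decr_nonneg _ _ _ _ _)
    let z : ℕ → Fin d → ℤ := fun n i => if (i : ℕ) < n then y i else x i
    have h0 : z 0 = x := by funext i; simp [z]
    have hd : z d = y := by funext i; simp [z]
    have hz : g x - g y = ∑ j : Fin d, (g (z j) - g (z (j + 1))) := by
      rw [Fin.sum_univ_eq_sum_range (fun n => g (z n) - g (z (n + 1))), Finset.sum_range_sub',
        h0, hd]
    rw [hz]
    refine Finset.sum_le_sum fun j _ => ?_
    have hzj : z j ∈ cube k₂ w := by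
      refine Fintype.mem_piFinset.2 fun i => ?_
      simp only [z]
      split_ifs
      · exact Fintype.mem_piFinset.1 hy i
      · exact Fintype.mem_piFinset.1 (mem_cube_mono hk hx) i
    have hup : z (j + 1) = Function.update (z j) j (y j) := by
      funext i
      by_cases hi : i = j
      · subst hi; simp [z]
      · rw [Function.update_of_ne hi]
        have : (i : ℕ) ≠ j := fun h => hi (Fin.ext h)
        simp only [z]
        congr 1
        simp only [eq_iff_iff]
        omega
    have := sub_update_le g hzj (i := j) (s := y j) (Fintype.mem_piFinset.1 hy j)
    rw [hup]
    exact this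
  calc _ ≤ ∑ x ∈ cube k₁ w, ∑ y ∈ cube k₂ w, ∑ j : Fin d, ∑ t ∈ side k₂ w j, decr k₂ w g j
        (Function.update (fun i : Fin d => if i < j then y i else x i) j t) :=
        Finset.sum_le_sum fun x hx => Finset.sum_le_sum fun y hy => key x hx y hy
    _ = ∑ j : Fin d, ∑ x ∈ cube k₁ w, ∑ y ∈ cube k₂ w, ∑ t ∈ side k₂ w j, decr k₂ w g j
        (Function.update (fun i : Fin d => if i < j then y i else x i) j t) := by
        rw [Finset.sum_comm (s := Finset.univ)]
        refine Finset.sum_congr rfl fun x _ => ?_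
        rw [Finset.sum_comm]
    _ ≤ ∑ j : Fin d, 2 ^ k₁ * ((2 ^ k₂) ^ d * ∑ u ∈ cube k₂ w, decr k₂ w g j u) :=
        Finset.sum_le_sum fun j _ => sum_decr_hybrid_le hk w g j
    _ = _ := by
        rw [Finset.sum_comm (s := cube k₂ w)]
        simp only [Finset.mul_sum]

lemma eq_of_nb_notMem {k : ℕ} {w u : Fin d → ℤ} {j : Fin d × Bool} (hu : u ∈ cube k w)
    (h : nb u j ∉ cube k w) :
    u j.1 = if j.2 then 2 ^ k * (w j.1 / 2 ^ k) + 2 ^ k - 1 else 2 ^ k * (w j.1 / 2 ^ k) := by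
  by_contra hne
  apply h
  refine Fintype.mem_piFinset.2 fun i => ?_
  have hi := Fintype.mem_piFinset.1 hu i
  by_cases hij : i = j.1
  · subst hij
    simp only [nb, Function.update_self, Finset.mem_Ico] at hi ⊢
    split_ifs at hne ⊢ <;> omega
  · rwa [nb, Function.update_of_ne hij]

/-- A discrete trace inequality on a face of a cube. -/
lemma sum_face_le (k : ℕ) (w : Fin d → ℤ) {h : (Fin d → ℤ) → ℝ} (hh : ∀ y, 0 ≤ h y)
    (j : Fin d × Bool) :
    2 ^ k * ∑ u ∈ cube k w with nb u j ∉ cube k w, h u ≤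
      ∑ u ∈ cube k w, h u + 2 ^ k * ∑ u ∈ cube k w, decr k w (fun y => -h y) j.1 u := by
  set S := (cube k w).filter fun u => nb u j ∉ cube k w with hS
  have lines : ∀ F : (Fin d → ℤ) → ℝ, (∀ y, 0 ≤ F y) →
      ∑ u ∈ S, ∑ s ∈ side k w j.1, F (Function.update u j.1 s) ≤ ∑ u ∈ cube k w, F u := by
    intro F hF
    rw [← Finset.sum_product']
    refine sum_le_sum_of_injOn' (fun p : (Fin d → ℤ) × ℤ => Function.update p.1 j.1 p.2) ?_ ?_
      fun b _ => hF b
    · rintro ⟨u, s⟩ hp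
      simp only [Finset.mem_product, hS, Finset.mem_filter] at hp
      refine Fintype.mem_piFinset.2 fun i => ?_
      by_cases hi : i = j.1
      · subst hi; simpa [side] using hp.2
      · simp only [Function.update_of_ne hi]
        exact Fintype.mem_piFinset.1 hp.1.1 i
    · rintro ⟨u, s⟩ hp ⟨u', s'⟩ hp' heq
      simp only [Finset.coe_product, Set.mem_prod, Finset.mem_coe, hS, Finset.mem_filter] at hp hp'
      simp only at heq
      have hs : s = s' := by simpa using congrFun heq j.1
      have e1 := eq_of_nb_notMem hp.1.1 hp.1.2
      have e2 := eq_of_nb_notMem hp'.1.1 hp'.1.2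
      simp only [Prod.mk.injEq]
      refine ⟨funext fun i => ?_, hs⟩
      by_cases hi : i = j.1
      · rw [hi, e1, e2]
      · have := congrFun heq i
        simpa only [Function.update_of_ne hi] using this
  have key : ∀ u ∈ S, 2 ^ k * h u ≤ ∑ s ∈ side k w j.1, h (Function.update u j.1 s) +
      2 ^ k * ∑ s ∈ side k w j.1, decr k w (fun y => -h y) j.1 (Function.update u j.1 s) := by
    intro u hu
    have huQ := (Finset.mem_filter.1 hu).1
    have : ∀ s ∈ side k w j.1, h u ≤ h (Function.update u j.1 s) +
        ∑ t ∈ side k w j.1, decr k w (fun y => -h y) j.1 (Function.update u j.1 t) := by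
      intro s hs
      have hz : Function.update u j.1 s ∈ cube k w := by
        refine Fintype.mem_piFinset.2 fun i => ?_
        by_cases hi : i = j.1
        · subst hi; simpa [side] using hs
        · simp only [Function.update_of_ne hi]
          exact Fintype.mem_piFinset.1 huQ i
      have := sub_update_le (fun y => -h y) hz (i := j.1) (s := u j.1)
        (Fintype.mem_piFinset.1 huQ j.1)
      simp only [Function.update_idem, Function.update_eq_self] at this
      linarith
    have := Finset.sum_le_sum this
    simpa [Finset.sum_add_distrib, card_side] using this
  calc _ = ∑ u ∈ S, 2 ^ k * h u := by rw [Finset.mul_sum]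
    _ ≤ _ := Finset.sum_le_sum key
    _ ≤ _ := by
      rw [Finset.sum_add_distrib, ← Finset.mul_sum]
      gcongr
      · exact lines h hh
      · exact lines _ fun y => decr_nonneg _ _ _ _ _

end

section

open scoped Classical

variable {d : ℕ}

lemma levels_eq_indicator (a b r : ℝ) :
    (fun μ : ℝ => if a ≤ μ ∧ μ < b then r else 0) = (Set.Ico a b).indicator fun _ => r := by
  funext μ
  simp [Set.indicator, Set.mem_Ico]

lemma integrable_levels (a b r : ℝ) :
    Integrable (fun μ : ℝ => if a ≤ μ ∧ μ < b then r else 0) := by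
  rw [levels_eq_indicator, integrable_indicator_iff measurableSet_Ico]
  exact integrableOn_const (by simp)

lemma integral_sum_levels {ι : Type*} (s : Finset ι) (c u v : ι → ℝ) :
    ∫ μ : ℝ, ∑ i ∈ s, (if v i ≤ μ ∧ μ < u i then c i else 0) =
      ∑ i ∈ s, c i * max (u i - v i) 0 := by
  rw [integral_finsetSum _ fun i _ => integrable_levels _ _ _]
  refine Finset.sum_congr rfl fun i _ => ?_
  rw [levels_eq_indicator, integral_indicator measurableSet_Ico, setIntegral_const, Measure.real,
    Real.volume_Ico, ENNReal.toReal_ofReal', smul_eq_mul, mul_comm]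

/-- A layer cake principle: sums of lengths of intervals may be compared levelwise. -/
lemma sum_mul_max_le_of_levels {ι κ : Type*} {s : Finset ι} {t : Finset κ} {c u v : ι → ℝ}
    {c' u' v' : κ → ℝ}
    (h : ∀ μ : ℝ, ∑ i ∈ s, (if v i ≤ μ ∧ μ < u i then c i else 0) ≤
      ∑ j ∈ t, (if v' j ≤ μ ∧ μ < u' j then c' j else 0)) :
    ∑ i ∈ s, c i * max (u i - v i) 0 ≤ ∑ j ∈ t, c' j * max (u' j - v' j) 0 := by
  rw [← integral_sum_levels, ← integral_sum_levels]
  exact integral_mono (integrable_finsetSum _ fun i _ => integrable_levels _ _ _)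
    (integrable_finsetSum _ fun i _ => integrable_levels _ _ _) h

/-- A finite family of cells with, around every cell `x`, admissible dyadic cubes of the
generations `k ≤ K x`, and a set of oriented edges containing all edges inside admissible cubes. -/
structure Grid (d : ℕ) where
  D : Finset (Fin d → ℤ)
  L : ℕ
  K : (Fin d → ℤ) → ℕ
  E : (Fin d → ℤ) → Fin d × Bool → Prop
  K_le : ∀ x ∈ D, K x ≤ L
  mem_D : ∀ {x k y}, x ∈ D → k ≤ K x → y ∈ cube k x → y ∈ D
  le_K : ∀ {x k y}, x ∈ D → k ≤ K x → y ∈ cube k x → k ≤ K y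
  E_mem : ∀ {x j}, x ∈ D → E x j → nb x j ∈ D
  E_cube : ∀ {x k u j}, x ∈ D → k ≤ K x → u ∈ cube k x → nb u j ∈ cube k x → E u j

namespace Grid

variable (G : Grid d)

/-- The sum of the decrements of `g` along the edges emanating from `x`. -/
def drop (g : (Fin d → ℤ) → ℝ) (x : Fin d → ℤ) : ℝ :=
  ∑ j, if G.E x j then max (g x - g (nb x j)) 0 else 0

/-- The variation of `g`. -/
def tv (g : (Fin d → ℤ) → ℝ) : ℝ := ∑ x ∈ G.D, G.drop g x

/-- The maximal function of `a`. -/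
def maxFun (a : (Fin d → ℤ) → ℝ) (x : Fin d → ℤ) : ℝ :=
  (Finset.range (G.K x + 1)).sup' Finset.nonempty_range_add_one fun k => avg k a x

lemma drop_nonneg (g : (Fin d → ℤ) → ℝ) (x : Fin d → ℤ) : 0 ≤ G.drop g x :=
  Finset.sum_nonneg fun j _ => by split_ifs <;> simp

variable {G} in
lemma sum_decr_le_drop {x : Fin d → ℤ} {k : ℕ} (hx : x ∈ G.D) (hk : k ≤ G.K x)
    (g : (Fin d → ℤ) → ℝ) {y : Fin d → ℤ} (hy : y ∈ cube k x) :
    ∑ i, decr k x g i y ≤ G.drop g y := by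
  simp only [decr, drop, Fintype.sum_prod_type]
  refine Finset.sum_le_sum fun i _ => Finset.sum_le_sum fun b _ => ?_
  by_cases h : nb y (i, b) ∈ cube k x
  · rw [if_pos h, if_pos (G.E_cube hx hk hy h)]
  · rw [if_neg h]
    split_ifs <;> simp

variable {G} in
lemma decr_le_drop {x : Fin d → ℤ} {k : ℕ} (hx : x ∈ G.D) (hk : k ≤ G.K x)
    (g : (Fin d → ℤ) → ℝ) {y : Fin d → ℤ} (hy : y ∈ cube k x) (i : Fin d) :
    decr k x g i y ≤ G.drop g y :=
  (Finset.single_le_sum (f := fun i => decr k x g i y) (fun _ _ => decr_nonneg _ _ _ _ _)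
    (Finset.mem_univ i)).trans (sum_decr_le_drop hx hk g hy)

/-- The indicator function of the superlevel set of `a` at level `μ`. -/
def _root_.DyadicGrid.lev (a : (Fin d → ℤ) → ℝ) (μ : ℝ) (x : Fin d → ℤ) : ℝ :=
  if μ < a x then 1 else 0

lemma _root_.DyadicGrid.lev_nonneg (a : (Fin d → ℤ) → ℝ) (μ : ℝ) (x : Fin d → ℤ) :
    0 ≤ lev a μ x := by
  unfold lev; split_ifs <;> simp

lemma _root_.DyadicGrid.lev_le_one (a : (Fin d → ℤ) → ℝ) (μ : ℝ) (x : Fin d → ℤ) :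
    lev a μ x ≤ 1 := by
  unfold lev; split_ifs <;> simp

variable {G} in
/-- Poincaré's inequality for indicator functions. -/
lemma avg_lev_mul_le {x : Fin d → ℤ} {k : ℕ} (hx : x ∈ G.D) (hk : k ≤ G.K x)
    (a : (Fin d → ℤ) → ℝ) (μ : ℝ) :
    avg k (lev a μ) x * (1 - avg k (lev a μ) x) ≤ 2 ^ k * avg k (G.drop (lev a μ)) x := by
  have h1 := sum_sum_sub_le (le_refl k) x (lev a μ)
  have h2 : ∑ y ∈ cube k x, ∑ z ∈ cube k x, max (lev a μ y - lev a μ z) 0 =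
      (∑ y ∈ cube k x, lev a μ y) * ∑ z ∈ cube k x, (1 - lev a μ z) := by
    rw [Finset.sum_mul_sum]
    refine Finset.sum_congr rfl fun y _ => Finset.sum_congr rfl fun z _ => ?_
    unfold lev
    split_ifs <;> simp
  have h3 : ∑ u ∈ cube k x, ∑ j, decr k x (lev a μ) j u ≤ (2 ^ k) ^ d * avg k (G.drop (lev a μ)) x := by
    rw [← sum_cube_eq]
    exact Finset.sum_le_sum fun u hu => sum_decr_le_drop hx hk _ hu
  have h4 : ∑ z ∈ cube k x, (1 - lev a μ z) = (2 ^ k) ^ d * (1 - avg k (lev a μ) x) := by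
    rw [Finset.sum_sub_distrib, sum_cube_eq, sum_cube_eq, avg_const]
    ring
  rw [h2, h4, sum_cube_eq] at h1
  have hM : (0 : ℝ) < (2 ^ k) ^ d := by positivity
  set M : ℝ := (2 ^ k) ^ d
  have h5 : M * M * (avg k (lev a μ) x * (1 - avg k (lev a μ) x)) ≤
      M * M * (2 ^ k * avg k (G.drop (lev a μ)) x) := by
    calc _ = M * avg k (lev a μ) x * (M * (1 - avg k (lev a μ) x)) := by ring
      _ ≤ _ := h1
      _ ≤ 2 ^ k * (M * (M * avg k (G.drop (lev a μ)) x)) := by gcongr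
      _ = _ := by ring
  exact le_of_mul_le_mul_left h5 (by positivity)

/-- The number of edges at `u` which leave the cube of generation `k` towards `{a ≤ μ}`. -/
def exits (a : (Fin d → ℤ) → ℝ) (μ : ℝ) (k : ℕ) (u : Fin d → ℤ) : ℝ :=
  ∑ j, if G.E u j ∧ nb u j ∉ cube k u ∧ a (nb u j) ≤ μ then 1 else 0

lemma avg_face_le (k : ℕ) (x : Fin d → ℤ) {h : (Fin d → ℤ) → ℝ} (hh : ∀ y, 0 ≤ h y)
    (j : Fin d × Bool) :
    2 ^ k * avg k (fun u => if nb u j ∉ cube k u then h u else 0) x ≤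
      avg k h x + 2 ^ k * avg k (decr k x (fun y => -h y) j.1) x := by
  have h1 := sum_face_le k x hh j
  have h2 : ∑ u ∈ cube k x with nb u j ∉ cube k x, h u =
      ∑ u ∈ cube k x, if nb u j ∉ cube k u then h u else 0 := by
    rw [Finset.sum_filter]
    refine Finset.sum_congr rfl fun u hu => ?_
    rw [cube_eq_of_mem hu]
  rw [h2, sum_cube_eq, sum_cube_eq, sum_cube_eq] at h1
  have hM : (0 : ℝ) < (2 ^ k) ^ d := by positivity
  set M : ℝ := (2 ^ k) ^ d
  refine le_of_mul_le_mul_left ?_ hM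
  linarith

lemma avg_exits_le_const (a : (Fin d → ℤ) → ℝ) (μ : ℝ) (k : ℕ) (x : Fin d → ℤ) :
    2 ^ k * avg k (G.exits a μ k) x ≤ 2 * d := by
  have h1 : avg k (G.exits a μ k) x ≤
      ∑ j : Fin d × Bool, avg k (fun u => if nb u j ∉ cube k u then 1 else 0) x := by
    rw [← avg_sum]
    refine avg_mono fun y _ => Finset.sum_le_sum fun j _ => ?_
    split_ifs <;> first | simp | tauto
  calc _ ≤ 2 ^ k * ∑ j : Fin d × Bool, avg k (fun u => if nb u j ∉ cube k u then 1 else 0) x := by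
        gcongr
    _ ≤ ∑ j : Fin d × Bool, 1 := by
        rw [Finset.mul_sum]
        refine Finset.sum_le_sum fun j _ => ?_
        have := avg_face_le k x (h := fun _ => 1) (fun _ => zero_le_one) j
        rw [avg_const] at this
        have h0 : decr k x (fun _ => -1) j.1 = fun _ => 0 := by
          funext t; simp [decr]
        rw [h0, avg_const] at this
        simpa using this
    _ = _ := by simp [mul_comm]

variable {G} in
lemma avg_exits_le {x : Fin d → ℤ} {k : ℕ} (hx : x ∈ G.D) (hk : k ≤ G.K x)
    (a : (Fin d → ℤ) → ℝ) (μ : ℝ) {θ : ℝ} (hθ : 0 < θ) (hd : θ ≤ avg k (lev a μ) x) :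
    avg k (G.exits a μ k) x ≤ (1 + 2 * d * (θ⁻¹ + 1)) * avg k (G.drop (lev a μ)) x := by
  set p := avg k (lev a μ) x with hp
  set e := avg k (G.drop (lev a μ)) x with he
  have he0 : 0 ≤ e := avg_nonneg fun y _ => G.drop_nonneg _ _
  have hp1 : p ≤ 1 := by
    rw [hp, ← avg_const k 1 x]; exact avg_mono fun y _ => lev_le_one a μ y
  have hP : 1 - p ≤ θ⁻¹ * (2 ^ k * e) := by
    have := avg_lev_mul_le hx hk a μ
    rw [← hp, ← he] at this
    rw [le_inv_mul_iff₀ hθ]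
    exact (mul_le_mul_of_nonneg_right hd (by linarith)).trans this
  have h1 : avg k (G.exits a μ k) x ≤ e +
      ∑ j : Fin d × Bool, avg k (fun u => if nb u j ∉ cube k u then 1 - lev a μ u else 0) x := by
    rw [← avg_sum, he, ← avg_add]
    refine avg_mono fun y _ => ?_
    rw [exits, drop, ← Finset.sum_add_distrib]
    refine Finset.sum_le_sum fun j _ => ?_
    by_cases h : G.E y j ∧ nb y j ∉ cube k y ∧ a (nb y j) ≤ μ
    · rw [if_pos h, if_pos h.1, if_pos h.2.1]
      have : lev a μ (nb y j) = 0 := by simp [lev, h.2.2]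
      rw [this, sub_zero]
      have := le_max_left (lev a μ y) 0
      linarith
    · rw [if_neg h]
      have := lev_le_one a μ y
      have h2 : 0 ≤ 1 - lev a μ y := by linarith
      have h3 := le_max_right (lev a μ y - lev a μ (nb y j)) 0
      split_ifs <;> linarith
  have h2 : ∀ j : Fin d × Bool, 2 ^ k *
      avg k (fun u => if nb u j ∉ cube k u then 1 - lev a μ u else 0) x ≤
      2 ^ k * ((θ⁻¹ + 1) * e) := by
    intro j
    refine (avg_face_le k x (h := fun u => 1 - lev a μ u)
      (fun y => by linarith [lev_le_one a μ y]) j).trans ?_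
    have e1 : avg k (fun u => 1 - lev a μ u) x = 1 - p := by
      simp only [sub_eq_add_neg]
      rw [avg_add, avg_const, avg_neg]
    have e2 : avg k (decr k x (fun y => -(1 - lev a μ y)) j.1) x ≤ e := by
      refine avg_mono fun y hy => ?_
      have : decr k x (fun y => -(1 - lev a μ y)) j.1 y = decr k x (lev a μ) j.1 y := by
        simp [decr]
      rw [this]
      exact decr_le_drop hx hk _ hy _
    rw [e1]
    calc _ ≤ θ⁻¹ * (2 ^ k * e) + 2 ^ k * e := by gcongr
      _ = _ := by ring
  calc _ ≤ _ := h1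
    _ ≤ e + ∑ j : Fin d × Bool, (θ⁻¹ + 1) * e := by
      gcongr with j
      exact le_of_mul_le_mul_left (h2 j) (by positivity)
    _ = _ := by
      simp [mul_comm]
      ring

end Grid
end

section

open scoped Classical

variable {d : ℕ}

lemma sum_mul_max_le_of_levels_add {ι κ κ' : Type*} {s : Finset ι} {t : Finset κ}
    {t' : Finset κ'} {c u v : ι → ℝ} {c' u' v' : κ → ℝ} {c'' u'' v'' : κ' → ℝ}
    (h : ∀ μ : ℝ, ∑ i ∈ s, (if v i ≤ μ ∧ μ < u i then c i else 0) ≤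
      ∑ j ∈ t, (if v' j ≤ μ ∧ μ < u' j then c' j else 0) +
      ∑ j ∈ t', (if v'' j ≤ μ ∧ μ < u'' j then c'' j else 0)) :
    ∑ i ∈ s, c i * max (u i - v i) 0 ≤ ∑ j ∈ t, c' j * max (u' j - v' j) 0 +
      ∑ j ∈ t', c'' j * max (u'' j - v'' j) 0 := by
  have := sum_mul_max_le_of_levels (s := s) (t := t.disjSum t') (c := c) (u := u) (v := v)
    (c' := Sum.elim c' c'') (u' := Sum.elim u' u'') (v' := Sum.elim v' v'')
    (fun μ => by rw [Finset.sum_disjSum]; exact h μ)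
  rw [Finset.sum_disjSum] at this
  exact this

lemma sum_ite_le_of_unique {s : Finset ℕ} {P : ℕ → Prop} (hP : ∀ k l, P k → P l → k = l) {c : ℝ}
    (hc : 0 ≤ c) : ∑ k ∈ s, (if P k then c else 0) ≤ c := by
  by_cases h : ∃ k ∈ s, P k
  · obtain ⟨k, hks, hk⟩ := h
    rw [Finset.sum_eq_single_of_mem k hks fun l _ hl => if_neg fun h => hl (hP _ _ h hk), if_pos hk]
  · rw [Finset.sum_eq_zero fun k hk => if_neg fun h' => h ⟨k, hk, h'⟩]
    exact hc

lemma avg_le_avg_succ (r : ℕ) {g : (Fin d → ℤ) → ℝ} (hg : ∀ y, 0 ≤ g y) (x : Fin d → ℤ) :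
    avg r g x ≤ 2 ^ d * avg (r + 1) g x := by
  have h1 : ∑ y ∈ cube r x, g y ≤ ∑ y ∈ cube (r + 1) x, g y :=
    Finset.sum_le_sum_of_subset_of_nonneg (cube_subset_cube (by omega) x) fun y _ _ => hg y
  rw [sum_cube_eq, sum_cube_eq, pow_succ, mul_pow, mul_assoc] at h1
  exact le_of_mul_le_mul_left h1 (by positivity)

lemma lev_anti (a : (Fin d → ℤ) → ℝ) {μ ν : ℝ} (h : μ ≤ ν) (x : Fin d → ℤ) :
    lev a ν x ≤ lev a μ x := by
  unfold lev
  split_ifs <;> first | simp | linarith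

/-- The density threshold. -/
def tau (d : ℕ) : ℝ := (2 ^ (d + 1))⁻¹

lemma tau_pos : 0 < tau d := by unfold tau; positivity

lemma tau_le_one : tau d ≤ 1 := inv_le_one_of_one_le₀ (one_le_pow₀ (by norm_num))

/-- A cube is good if it contains many points at which `a` is at least its average. -/
def Good (a : (Fin d → ℤ) → ℝ) (j : ℕ) (x : Fin d → ℤ) : Prop :=
  tau d ≤ avg j (fun y => if avg j a x ≤ a y then 1 else 0) x

lemma good_zero (a : (Fin d → ℤ) → ℝ) (x : Fin d → ℤ) : Good a 0 x := by
  simp only [Good, avg_zero, le_refl, if_true]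
  exact tau_le_one

lemma good_iff {a : (Fin d → ℤ) → ℝ} {j : ℕ} {x y : Fin d → ℤ} (h : y ∈ cube j x) :
    Good a j y ↔ Good a j x := by
  simp only [Good, avg_eq_of_mem _ h]

/-- The generation of the largest good cube of generation at most `k` around `x`. -/
def stopGen (a : (Fin d → ℤ) → ℝ) (k : ℕ) (x : Fin d → ℤ) : ℕ :=
  Nat.findGreatest (fun j => Good a j x) k

lemma good_stopGen (a : (Fin d → ℤ) → ℝ) (k : ℕ) (x : Fin d → ℤ) : Good a (stopGen a k x) x :=
  Nat.findGreatest_spec (P := fun j => Good a j x) (Nat.zero_le k) (good_zero a x)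

lemma stopGen_le (a : (Fin d → ℤ) → ℝ) (k : ℕ) (x : Fin d → ℤ) : stopGen a k x ≤ k :=
  Nat.findGreatest_le k

lemma stopGen_eq_iff {a : (Fin d → ℤ) → ℝ} {j k : ℕ} {x y : Fin d → ℤ} (h : y ∈ cube j x) :
    stopGen a k y = j ↔ stopGen a k x = j := by
  simp only [stopGen, Nat.findGreatest_eq_iff, good_iff h]
  refine and_congr_right fun _ => and_congr_right fun _ => forall_congr' fun n => ?_
  refine imp_congr_right fun hn => ?_
  rw [good_iff (mem_cube_mono hn.le h)]

/-- Optional stopping. -/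
lemma avg_stop (a g : (Fin d → ℤ) → ℝ) (k : ℕ) (x : Fin d → ℤ) :
    avg k (fun y => avg (stopGen a k y) g y) x = avg k g x := by
  have key : ∀ F : ℕ → (Fin d → ℤ) → ℝ, ∑ y ∈ cube k x, F (stopGen a k y) y =
      ∑ j ∈ Finset.range (k + 1), ∑ y ∈ cube k x, (if stopGen a k y = j then 1 else 0) * F j y := by
    intro F
    rw [Finset.sum_comm]
    refine Finset.sum_congr rfl fun y _ => ?_
    rw [Finset.sum_eq_single_of_mem (stopGen a k y)
      (Finset.mem_range.2 (Nat.lt_succ_of_le (stopGen_le a k y)))]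
    · simp
    · intro j _ hj
      rw [if_neg hj.symm, zero_mul]
  unfold avg
  congr 1
  have h1 := key fun j y => avg j g y
  have h2 := key fun _ y => g y
  simp only [avg] at h1
  rw [h1, h2]
  refine Finset.sum_congr rfl fun j hj => ?_
  have hjk : j ≤ k := Nat.lt_succ_iff.1 (Finset.mem_range.1 hj)
  refine sum_mul_avg (w := fun y => if stopGen a k y = j then 1 else 0) ?_ ?_ g
  · intro y hy z hz
    rw [← cube_eq_of_mem hy]
    exact mem_cube_mono hjk hz
  · intro y _ z hz
    simp only [stopGen_eq_iff hz]

/-- The excess of the stopped averages over the average. -/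
def excess (a : (Fin d → ℤ) → ℝ) (k : ℕ) (y : Fin d → ℤ) : ℝ :=
  max (avg (stopGen a k y) a y - avg k a y) 0

lemma sub_le_avg_excess (a : (Fin d → ℤ) → ℝ) {k : ℕ} {x : Fin d → ℤ} {l : ℝ}
    (hl : l < avg k a x) (hd : avg k (lev a l) x ≤ tau d / 2) :
    avg k a x - l ≤ 2 * avg k (excess a k) x := by
  set f := avg k a x with hf
  have h1 : f ≤ avg k (fun y => (excess a k y + (f - l) * (tau d)⁻¹ * avg (stopGen a k y) (lev a l) y)
      + l) x := by
    rw [hf, ← avg_stop a a k x]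
    refine avg_mono fun y hy => ?_
    rw [avg_stop, excess, avg_eq_of_mem a hy, ← hf]
    set s := avg (stopGen a k y) a y with hs
    have h0 : 0 ≤ avg (stopGen a k y) (lev a l) y := avg_nonneg fun _ _ => lev_nonneg _ _ _
    have hτ := tau_pos (d := d)
    rcases le_or_gt s l with h | h
    · have : 0 ≤ (f - l) * (tau d)⁻¹ * avg (stopGen a k y) (lev a l) y :=
        mul_nonneg (mul_nonneg (by linarith) (by positivity)) h0
      have := le_max_right (s - f) 0
      linarith
    · have h2 : tau d ≤ avg (stopGen a k y) (lev a l) y := by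
        refine (good_stopGen a k y).trans (avg_mono fun z _ => ?_)
        rw [← hs]
        unfold lev
        split_ifs <;> first | simp | linarith
      have h3 : f - l ≤ (f - l) * (tau d)⁻¹ * avg (stopGen a k y) (lev a l) y := by
        rw [mul_assoc]
        refine le_mul_of_one_le_right (by linarith) ?_
        rw [inv_mul_eq_div, one_le_div hτ]
        exact h2
      have := le_max_left (s - f) 0
      linarith
  rw [avg_add, avg_add, avg_const, avg_mul_left, avg_stop] at h1
  have h2 : (f - l) * (tau d)⁻¹ * avg k (lev a l) x ≤ (f - l) / 2 := by
    have hτ := tau_pos (d := d)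
    calc _ ≤ (f - l) * (tau d)⁻¹ * (tau d / 2) := by
          refine mul_le_mul_of_nonneg_left hd (mul_nonneg (by linarith) (by positivity))
      _ = _ := by field_simp
  linarith

namespace Grid

variable (G : Grid d)

lemma drop_lev (a : (Fin d → ℤ) → ℝ) (μ : ℝ) (x : Fin d → ℤ) : G.drop (lev a μ) x =
    ∑ j, if a (nb x j) ≤ μ ∧ μ < a x then (if G.E x j then 1 else 0) else 0 := by
  unfold drop lev
  refine Finset.sum_congr rfl fun j _ => ?_
  rcases le_or_gt (a (nb x j)) μ with h1 | h1 <;> rcases le_or_gt (a x) μ with h2 | h2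
  · simp [h1, not_lt.2 h1, not_lt.2 h2]
  · simp [h1, h2, not_lt.2 h1]
  · simp [h1, not_le.2 h1, not_lt.2 h2]
  · simp [h1, h2, not_le.2 h1]

variable {G} in
lemma le_K_iff {x y : Fin d → ℤ} {j k : ℕ} (hx : x ∈ G.D) (hj : j ≤ G.K x) (hy : y ∈ cube j x)
    (hjk : j ≤ k) : k ≤ G.K y ↔ k ≤ G.K x := by
  constructor
  · intro h
    exact G.le_K (G.mem_D hx hj hy) h (mem_cube_comm.1 (mem_cube_mono hjk hy))
  · intro h
    exact G.le_K hx h (mem_cube_mono hjk hy)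

lemma sum_ite_avg {k : ℕ} {P : (Fin d → ℤ) → Prop} (hP : ∀ x, P x → k ≤ G.K x)
    (hinv : ∀ x ∈ G.D, k ≤ G.K x → ∀ y ∈ cube k x, P y ↔ P x) (g : (Fin d → ℤ) → ℝ) :
    ∑ x ∈ G.D, (if P x then avg k g x else 0) = ∑ x ∈ G.D, if P x then g x else 0 := by
  have h : ∀ F : (Fin d → ℤ) → ℝ, ∑ x ∈ G.D, (if P x then F x else 0) =
      ∑ x ∈ G.D with k ≤ G.K x, (if P x then 1 else 0) * F x := by
    intro F
    rw [Finset.sum_filter]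
    refine Finset.sum_congr rfl fun x _ => ?_
    by_cases h : P x
    · simp [h, hP x h]
    · simp [h]
  rw [h, h]
  refine sum_mul_avg (w := fun x => if P x then 1 else 0) ?_ ?_ g
  · intro x hx y hy
    rw [Finset.mem_filter] at hx ⊢
    exact ⟨G.mem_D hx.1 hx.2 hy, G.le_K hx.1 hx.2 hy⟩
  · intro x hx y hy
    rw [Finset.mem_filter] at hx
    simp only [hinv x hx.1 hx.2 y hy]

/-- The cube of generation `k` around `x` is a maximal admissible cube with average above `l`. -/
def Sel (a : (Fin d → ℤ) → ℝ) (l : ℝ) (k : ℕ) (x : Fin d → ℤ) : Prop :=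
  k ≤ G.K x ∧ l < avg k a x ∧ ∀ j, k < j → j ≤ G.K x → avg j a x ≤ l

/-- Larger admissible cubes have smaller averages, and `a` is above its average only on a small
part of the cube. -/
def Top (a : (Fin d → ℤ) → ℝ) (k : ℕ) (x : Fin d → ℤ) : Prop :=
  k ≤ G.K x ∧ (∀ j, k < j → j ≤ G.K x → avg j a x < avg k a x) ∧
    avg k (lev a (avg k a x)) x < tau d

variable {G}

lemma sel_iff {a : (Fin d → ℤ) → ℝ} {l : ℝ} {k : ℕ} {x y : Fin d → ℤ} (hx : x ∈ G.D)
    (hk : k ≤ G.K x) (hy : y ∈ cube k x) : G.Sel a l k y ↔ G.Sel a l k x := by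
  simp only [Sel, le_K_iff hx hk hy le_rfl, avg_eq_of_mem a hy]
  refine and_congr_right fun _ => and_congr_right fun _ => forall_congr' fun j => ?_
  refine imp_congr_right fun hj => ?_
  rw [le_K_iff hx hk hy hj.le, avg_eq_of_mem a (mem_cube_mono hj.le hy)]

lemma top_iff {a : (Fin d → ℤ) → ℝ} {r k : ℕ} (hrk : r ≤ k) {x y : Fin d → ℤ} (hx : x ∈ G.D)
    (hr : r ≤ G.K x) (hy : y ∈ cube r x) : G.Top a k y ↔ G.Top a k x := by
  have hyk := mem_cube_mono hrk hy
  simp only [Top, le_K_iff hx hr hy hrk, avg_eq_of_mem _ hyk]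
  refine and_congr_right fun _ => and_congr_left fun _ => forall_congr' fun j => ?_
  refine imp_congr_right fun hj => ?_
  rw [le_K_iff hx hr hy (hrk.trans hj.le), avg_eq_of_mem a (mem_cube_mono hj.le hyk)]

lemma Sel.unique {a : (Fin d → ℤ) → ℝ} {l : ℝ} {k k' : ℕ} {x : Fin d → ℤ} (h : G.Sel a l k x)
    (h' : G.Sel a l k' x) : k = k' := by
  rcases lt_trichotomy k k' with hlt | heq | hlt
  · exact absurd (h.2.2 k' hlt h'.1) h'.2.1.not_ge
  · exact heq
  · exact absurd (h'.2.2 k hlt h.1) h.2.1.not_ge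

lemma exists_sel {a : (Fin d → ℤ) → ℝ} {l : ℝ} {x : Fin d → ℤ} (h : l < G.maxFun a x) :
    ∃ k, G.Sel a l k x := by
  obtain ⟨k, hk, hl⟩ := (Finset.lt_sup'_iff _).1 h
  rw [Finset.mem_range, Nat.lt_succ_iff] at hk
  refine ⟨Nat.findGreatest (fun j => l < avg j a x) (G.K x), Nat.findGreatest_le _,
    Nat.findGreatest_spec (P := fun j => l < avg j a x) hk hl, fun j h1 h2 => ?_⟩
  exact not_lt.1 (Nat.findGreatest_is_greatest h1 h2)

lemma avg_le_maxFun {a : (Fin d → ℤ) → ℝ} {k : ℕ} {x : Fin d → ℤ} (hk : k ≤ G.K x) :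
    avg k a x ≤ G.maxFun a x :=
  Finset.le_sup' (fun k => avg k a x) (Finset.mem_range.2 (Nat.lt_succ_of_le hk))

lemma le_maxFun (a : (Fin d → ℤ) → ℝ) (x : Fin d → ℤ) : a x ≤ G.maxFun a x := by
  have := avg_le_maxFun (G := G) (a := a) (x := x) (Nat.zero_le _)
  rwa [avg_zero] at this

lemma Sel.top {a : (Fin d → ℤ) → ℝ} {l : ℝ} {k : ℕ} {x : Fin d → ℤ} (h : G.Sel a l k x)
    (hd : avg k (lev a l) x < tau d / 2) :
    G.Top a k x ∧ avg k a x - 2 * avg k (excess a k) x ≤ l ∧ l < avg k a x := by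
  refine ⟨⟨h.1, fun j h1 h2 => (h.2.2 j h1 h2).trans_lt h.2.1, ?_⟩, ?_, h.2.1⟩
  · have := avg_mono (k := k) (x := x) fun y _ => lev_anti a h.2.1.le y
    have hτ := tau_pos (d := d)
    linarith
  · have := sub_le_avg_excess a h.2.1 hd.le
    linarith

variable (G)

lemma sum_sel_le (a : (Fin d → ℤ) → ℝ) (l : ℝ) (b : ℕ → (Fin d → ℤ) → ℝ) {α β : ℝ}
    (hα : 0 ≤ α) (hβ : 0 ≤ β)
    (hbα : ∀ x ∈ G.D, ∀ k ≤ G.K x, avg k (b k) x ≤ α * (2 ^ k)⁻¹)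
    (hbβ : ∀ x ∈ G.D, ∀ k ≤ G.K x, tau d / 2 ≤ avg k (lev a l) x →
      avg k (b k) x ≤ β * avg k (G.drop (lev a l)) x) :
    ∑ x ∈ G.D, ∑ k ∈ Finset.range (G.L + 1), (if G.Sel a l k x then b k x else 0) ≤
      β * ∑ x ∈ G.D, G.drop (lev a l) x +
      ∑ x ∈ G.D, ∑ k ∈ Finset.range (G.L + 1),
        if avg k a x - 2 * avg k (excess a k) x ≤ l ∧ l < avg k a x then
          (if G.Top a k x then α * (2 ^ k)⁻¹ else 0) else 0 := by
  have h1 : ∀ k, ∑ x ∈ G.D, (if G.Sel a l k x then b k x else 0) ≤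
      β * (∑ x ∈ G.D, if G.Sel a l k x then G.drop (lev a l) x else 0) +
      ∑ x ∈ G.D, if avg k a x - 2 * avg k (excess a k) x ≤ l ∧ l < avg k a x then
          (if G.Top a k x then α * (2 ^ k)⁻¹ else 0) else 0 := by
    intro k
    have hinv : ∀ x ∈ G.D, k ≤ G.K x → ∀ y ∈ cube k x, G.Sel a l k y ↔ G.Sel a l k x :=
      fun x hx hk y hy => sel_iff hx hk hy
    rw [← G.sum_ite_avg (fun x h => h.1) hinv (b k),
      ← G.sum_ite_avg (fun x h => h.1) hinv (G.drop (lev a l)), Finset.mul_sum, ← Finset.sum_add_distrib]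
    refine Finset.sum_le_sum fun x hx => ?_
    by_cases h : G.Sel a l k x
    · rw [if_pos h, if_pos h]
      have h0 : 0 ≤ avg k (G.drop (lev a l)) x := avg_nonneg fun y _ => G.drop_nonneg _ _
      by_cases hd : tau d / 2 ≤ avg k (lev a l) x
      · have : (0 : ℝ) ≤ if avg k a x - 2 * avg k (excess a k) x ≤ l ∧ l < avg k a x then
          (if G.Top a k x then α * (2 ^ k)⁻¹ else 0) else 0 := by
          split_ifs <;> positivity
        have := hbβ x hx k h.1 hd
        linarith
      · obtain ⟨ht, hl⟩ := h.top (not_le.1 hd)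
        rw [if_pos hl, if_pos ht]
        have := hbα x hx k h.1
        have := mul_nonneg hβ h0
        linarith
    · rw [if_neg h, if_neg h, mul_zero, zero_add]
      split_ifs <;> positivity
  rw [Finset.sum_comm, Finset.sum_comm (s := G.D) (t := Finset.range (G.L + 1))]
  refine (Finset.sum_le_sum fun k _ => h1 k).trans ?_
  rw [Finset.sum_add_distrib, ← Finset.mul_sum]
  gcongr
  rw [Finset.sum_comm]
  exact Finset.sum_le_sum fun x _ =>
    sum_ite_le_of_unique (fun k k' h h' => Sel.unique h h') (G.drop_nonneg _ _)

/-- The cube of generation `r` around `y` is maximal among the subcubes of some selected cube in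
which `{a > μ}` has large density. -/
def Dense (a : (Fin d → ℤ) → ℝ) (μ : ℝ) (r : ℕ) (y : Fin d → ℤ) : Prop :=
  r ≤ G.K y ∧ tau d ≤ avg r (lev a μ) y ∧ μ < avg r a y ∧
    ∃ k, r < k ∧ G.Top a k y ∧ avg k a y ≤ μ ∧ ∀ j, r < j → j ≤ k → avg j (lev a μ) y < tau d

variable {G}

lemma dense_iff {a : (Fin d → ℤ) → ℝ} {μ : ℝ} {r : ℕ} {x y : Fin d → ℤ} (hx : x ∈ G.D)
    (hr : r ≤ G.K x) (hy : y ∈ cube r x) : G.Dense a μ r y ↔ G.Dense a μ r x := by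
  simp only [Dense, le_K_iff hx hr hy le_rfl, avg_eq_of_mem _ hy]
  refine and_congr_right fun _ => and_congr_right fun _ => and_congr_right fun _ =>
    exists_congr fun k => and_congr_right fun hk => ?_
  rw [top_iff hk.le hx hr hy, avg_eq_of_mem a (mem_cube_mono hk.le hy)]
  refine and_congr_right fun _ => and_congr_right fun _ => forall_congr' fun j =>
    imp_congr_right fun hj => ?_
  rw [avg_eq_of_mem _ (mem_cube_mono hj.le hy)]

lemma Dense.le {a : (Fin d → ℤ) → ℝ} {μ : ℝ} {r s : ℕ} {y : Fin d → ℤ} (hr : G.Dense a μ r y)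
    (hs : G.Dense a μ s y) : s ≤ r := by
  by_contra! hlt
  obtain ⟨k, hrk, ht, hkμ, hk⟩ := hr.2.2.2
  have hks : k < s := by
    by_contra! h
    exact absurd (hk s hlt h) hs.2.1.not_gt
  have := ht.2.1 s hks hs.1
  linarith [hs.2.2.1]

lemma exists_dense {a : (Fin d → ℤ) → ℝ} {μ : ℝ} {k : ℕ} {y : Fin d → ℤ} (ht : G.Top a k y)
    (h1 : avg k a y ≤ μ) (h2 : μ < avg (stopGen a k y) a y) : ∃ r < k, G.Dense a μ r y := by
  set s := stopGen a k y with hs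
  have hsd : tau d ≤ avg s (lev a μ) y := by
    refine (good_stopGen a k y).trans (avg_mono fun z _ => ?_)
    rw [← hs]
    unfold lev
    split_ifs <;> first | simp | linarith
  set r := Nat.findGreatest (fun j => tau d ≤ avg j (lev a μ) y) k with hr
  have hsr : s ≤ r := Nat.le_findGreatest (stopGen_le a k y) hsd
  have hrd : tau d ≤ avg r (lev a μ) y :=
    Nat.findGreatest_spec (P := fun j => tau d ≤ avg j (lev a μ) y) (stopGen_le a k y) hsd
  have hrk : r ≤ k := Nat.findGreatest_le _
  have hne : r ≠ k := by
    intro h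
    rw [h] at hrd
    have := avg_mono (k := k) (x := y) fun z _ => lev_anti a h1 z
    linarith [ht.2.2]
  have hlt : r < k := lt_of_le_of_ne hrk hne
  refine ⟨r, hlt, hrk.trans ht.1, hrd, ?_, k, hlt, ht, h1, fun j h3 h4 =>
    not_le.1 (Nat.findGreatest_is_greatest h3 h4)⟩
  rcases hsr.eq_or_lt with h | h
  · rwa [← h]
  · have hng : ¬ Good a r y := Nat.findGreatest_is_greatest (P := fun j => Good a j y) h hrk
    by_contra! hle
    refine hng (hrd.trans (avg_mono fun z _ => ?_))
    unfold lev
    split_ifs <;> first | simp | linarith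

lemma Dense.inv_le {a : (Fin d → ℤ) → ℝ} {μ : ℝ} {r : ℕ} {y : Fin d → ℤ} (hy : y ∈ G.D)
    (h : G.Dense a μ r y) : (2 ^ r)⁻¹ ≤ 2 ^ (d + 2) * avg r (G.drop (lev a μ)) y := by
  have h1 := avg_lev_mul_le hy h.1 a μ
  obtain ⟨hr, hd, -, k, hrk, -, -, hk⟩ := h
  have h2 := hk (r + 1) (by omega) (by omega)
  have h3 := avg_le_avg_succ r (lev_nonneg a μ) y
  set p := avg r (lev a μ) y
  have h4 : p ≤ 1 / 2 := by
    have : (2 : ℝ) ^ d * tau d = 1 / 2 := by unfold tau; rw [pow_succ]; field_simp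
    rw [← this]
    exact h3.trans (by gcongr)
  have h5 : tau d * (1 / 2) ≤ p * (1 - p) :=
    mul_le_mul hd (by linarith) (by norm_num) (tau_pos.le.trans hd)
  have h6 : tau d * (1 / 2) = (2 ^ (d + 2))⁻¹ := by
    unfold tau; rw [pow_succ _ (d + 1)]; field_simp
  rw [h6] at h5
  have h7 := h5.trans h1
  rw [inv_le_iff_one_le_mul₀ (by positivity)] at h7 ⊢
  linarith

variable (G)

lemma sum_top_le (a : (Fin d → ℤ) → ℝ) (μ : ℝ) :
    ∑ y ∈ G.D, ∑ k ∈ Finset.range (G.L + 1),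
      (if avg k a y ≤ μ ∧ μ < avg (stopGen a k y) a y then
        (if G.Top a k y then ((2 : ℝ) ^ k)⁻¹ else 0) else 0) ≤
      2 ^ (d + 2) * ∑ y ∈ G.D, G.drop (lev a μ) y := by
  have h1 : ∀ y ∈ G.D, ∑ k ∈ Finset.range (G.L + 1),
      (if avg k a y ≤ μ ∧ μ < avg (stopGen a k y) a y then
        (if G.Top a k y then ((2 : ℝ) ^ k)⁻¹ else 0) else 0) ≤
      ∑ r ∈ Finset.range (G.L + 1), if G.Dense a μ r y then ((2 : ℝ) ^ r)⁻¹ else 0 := by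
    intro y hy
    by_cases h : ∃ r, G.Dense a μ r y
    · obtain ⟨r, hr⟩ := h
      have hgeom : ∀ n, ∑ k ∈ Finset.range n, (if r < k then ((2 : ℝ) ^ k)⁻¹ else 0) ≤
          if r < n then (2 ^ r)⁻¹ - 2 * (2 ^ n)⁻¹ else 0 := by
        intro n
        induction n with
        | zero => simp
        | succ n ih =>
          rw [Finset.sum_range_succ]
          have e : (2 : ℝ) * (2 ^ (n + 1))⁻¹ = (2 ^ n)⁻¹ := by rw [pow_succ]; field_simp
          rw [e]
          rcases lt_trichotomy r n with h | h | h
          · rw [if_pos h] at ih ⊢; rw [if_pos (by omega)]; linarith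
          · subst h
            rw [if_neg (lt_irrefl _)] at ih ⊢
            rw [if_pos (Nat.lt_succ_self _)]
            linarith
          · rw [if_neg (by omega)] at ih ⊢; rw [if_neg (by omega)]; linarith
      calc _ ≤ ∑ k ∈ Finset.range (G.L + 1), (if r < k then ((2 : ℝ) ^ k)⁻¹ else 0) := by
            refine Finset.sum_le_sum fun k _ => ?_
            by_cases hc : (avg k a y ≤ μ ∧ μ < avg (stopGen a k y) a y) ∧ G.Top a k y
            · obtain ⟨s, hsk, hs⟩ := exists_dense hc.2 hc.1.1 hc.1.2
              have : s = r := le_antisymm (hr.le hs) (hs.le hr)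
              rw [if_pos hc.1, if_pos hc.2, if_pos (this ▸ hsk)]
            · have : (0 : ℝ) ≤ if r < k then ((2 : ℝ) ^ k)⁻¹ else 0 := by
                split_ifs <;> positivity
              rw [← ite_and, if_neg hc]
              exact this
        _ ≤ (2 ^ r)⁻¹ := by
            refine (hgeom _).trans ?_
            have : (0 : ℝ) ≤ 2 * (2 ^ (G.L + 1))⁻¹ := by positivity
            have : (0 : ℝ) ≤ (2 ^ r)⁻¹ := by positivity
            split_ifs <;> linarith
        _ ≤ _ := by
            have := Finset.single_le_sum (s := Finset.range (G.L + 1))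
              (f := fun r => if G.Dense a μ r y then ((2 : ℝ) ^ r)⁻¹ else 0)
              (fun i _ => by split_ifs <;> positivity)
              (Finset.mem_range.2 (Nat.lt_succ_of_le (hr.1.trans (G.K_le y hy))))
            rwa [if_pos hr] at this
    · refine Finset.sum_le_sum fun k _ => ?_
      have : ¬ ((avg k a y ≤ μ ∧ μ < avg (stopGen a k y) a y) ∧ G.Top a k y) := by
        rintro ⟨h1, h2⟩
        obtain ⟨s, -, hs⟩ := exists_dense h2 h1.1 h1.2
        exact h ⟨s, hs⟩
      rw [← ite_and, if_neg this]
      split_ifs <;> positivity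
  refine (Finset.sum_le_sum h1).trans ?_
  calc _ ≤ ∑ y ∈ G.D, ∑ r ∈ Finset.range (G.L + 1), 2 ^ (d + 2) *
        (if G.Dense a μ r y then avg r (G.drop (lev a μ)) y else 0) := by
        refine Finset.sum_le_sum fun y hy => Finset.sum_le_sum fun r _ => ?_
        split_ifs with h
        · exact h.inv_le hy
        · simp
    _ = 2 ^ (d + 2) * ∑ r ∈ Finset.range (G.L + 1), ∑ y ∈ G.D,
        (if G.Dense a μ r y then G.drop (lev a μ) y else 0) := by
        rw [Finset.sum_comm, Finset.mul_sum]
        refine Finset.sum_congr rfl fun r _ => ?_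
        rw [← G.sum_ite_avg (fun y h => h.1) fun x hx hr y hy => dense_iff hx hr hy,
          Finset.mul_sum]
    _ ≤ _ := by
        rw [Finset.sum_comm]
        gcongr with y
        exact sum_ite_le_of_unique (fun r s hr hs => le_antisymm (hs.le hr) (hr.le hs))
          (G.drop_nonneg _ _)

lemma tv_eq (g : (Fin d → ℤ) → ℝ) : G.tv g = ∑ p ∈ G.D ×ˢ (Finset.univ : Finset (Fin d × Bool)),
    (if G.E p.1 p.2 then 1 else 0) * max (g p.1 - g (nb p.1 p.2)) 0 := by
  rw [Finset.sum_product]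
  simp [tv, drop]

lemma sum_drop_lev (a : (Fin d → ℤ) → ℝ) (μ : ℝ) : ∑ x ∈ G.D, G.drop (lev a μ) x =
    ∑ p ∈ G.D ×ˢ (Finset.univ : Finset (Fin d × Bool)),
      if a (nb p.1 p.2) ≤ μ ∧ μ < a p.1 then (if G.E p.1 p.2 then 1 else 0) else 0 := by
  rw [Finset.sum_product]
  simp only [drop_lev]

lemma sum_top_excess_le (a : (Fin d → ℤ) → ℝ) :
    ∑ y ∈ G.D, ∑ k ∈ Finset.range (G.L + 1),
      (if G.Top a k y then ((2 : ℝ) ^ k)⁻¹ else 0) * avg k (excess a k) y ≤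
      2 ^ (d + 2) * G.tv a := by
  have h1 : ∑ y ∈ G.D, ∑ k ∈ Finset.range (G.L + 1),
      (if G.Top a k y then ((2 : ℝ) ^ k)⁻¹ else 0) * avg k (excess a k) y =
      ∑ y ∈ G.D, ∑ k ∈ Finset.range (G.L + 1),
      (if G.Top a k y then ((2 : ℝ) ^ k)⁻¹ else 0) * excess a k y := by
    rw [Finset.sum_comm, Finset.sum_comm (s := G.D)]
    refine Finset.sum_congr rfl fun k _ => ?_
    have := G.sum_ite_avg (k := k) (fun x (h : G.Top a k x) => h.1)
      (fun x hx hk y hy => top_iff le_rfl hx hk hy) (excess a k)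
    simp only [ite_mul, zero_mul]
    simp only [← mul_ite_zero, ← Finset.mul_sum]
    rw [this]
  rw [h1, tv_eq, Finset.mul_sum]
  simp only [← mul_assoc]
  rw [← Finset.sum_product']
  refine sum_mul_max_le_of_levels (s := G.D ×ˢ Finset.range (G.L + 1))
    (c := fun p => if G.Top a p.2 p.1 then ((2 : ℝ) ^ p.2)⁻¹ else 0)
    (u := fun p => avg (stopGen a p.2 p.1) a p.1) (v := fun p => avg p.2 a p.1)
    (t := G.D ×ˢ (Finset.univ : Finset (Fin d × Bool)))
    (c' := fun p => 2 ^ (d + 2) * if G.E p.1 p.2 then 1 else 0)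
    (u' := fun p => a p.1) (v' := fun p => a (nb p.1 p.2)) fun μ => ?_
  have := G.sum_top_le a μ
  rw [sum_drop_lev, Finset.mul_sum] at this
  rw [Finset.sum_product]
  simpa only [mul_ite_zero] using this

end Grid
end

section

open scoped Classical

variable {d : ℕ}

namespace Grid

variable (G : Grid d)

lemma sum_mul_max_le_of_sel {ι : Type*} {s : Finset ι} {c u v : ι → ℝ}
    (a : (Fin d → ℤ) → ℝ) (b : ℝ → ℕ → (Fin d → ℤ) → ℝ) {α β : ℝ}
    (hα : 0 ≤ α) (hβ : 0 ≤ β)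
    (hbα : ∀ l, ∀ x ∈ G.D, ∀ k ≤ G.K x, avg k (b l k) x ≤ α * (2 ^ k)⁻¹)
    (hbβ : ∀ l, ∀ x ∈ G.D, ∀ k ≤ G.K x, tau d / 2 ≤ avg k (lev a l) x →
      avg k (b l k) x ≤ β * avg k (G.drop (lev a l)) x)
    (h : ∀ l : ℝ, ∑ i ∈ s, (if v i ≤ l ∧ l < u i then c i else 0) ≤
      ∑ x ∈ G.D, ∑ k ∈ Finset.range (G.L + 1), if G.Sel a l k x then b l k x else 0) :
    ∑ i ∈ s, c i * max (u i - v i) 0 ≤ (β + α * 2 ^ (d + 3)) * G.tv a := by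
  have key := sum_mul_max_le_of_levels_add (s := s) (c := c) (u := u) (v := v)
    (t := G.D ×ˢ (Finset.univ : Finset (Fin d × Bool)))
    (c' := fun p => β * if G.E p.1 p.2 then 1 else 0)
    (u' := fun p => a p.1) (v' := fun p => a (nb p.1 p.2))
    (t' := G.D ×ˢ Finset.range (G.L + 1))
    (c'' := fun p => if G.Top a p.2 p.1 then α * ((2 : ℝ) ^ p.2)⁻¹ else 0)
    (u'' := fun p => avg p.2 a p.1)
    (v'' := fun p => avg p.2 a p.1 - 2 * avg p.2 (excess a p.2) p.1) (fun l => by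
      refine (h l).trans ((G.sum_sel_le a l (b l) hα hβ (hbα l) (hbβ l)).trans ?_)
      rw [sum_drop_lev, Finset.mul_sum, Finset.sum_product (s := G.D) (t := Finset.range _)]
      simp only [mul_ite_zero]
      rfl)
  refine key.trans ?_
  have h1 : ∑ p ∈ G.D ×ˢ (Finset.univ : Finset (Fin d × Bool)),
      (β * if G.E p.1 p.2 then 1 else 0) * max (a p.1 - a (nb p.1 p.2)) 0 = β * G.tv a := by
    rw [tv_eq, Finset.mul_sum]
    simp only [mul_assoc]
  have h2 : ∑ p ∈ G.D ×ˢ Finset.range (G.L + 1),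
      (if G.Top a p.2 p.1 then α * ((2 : ℝ) ^ p.2)⁻¹ else 0) *
        max (avg p.2 a p.1 - (avg p.2 a p.1 - 2 * avg p.2 (excess a p.2) p.1)) 0 =
      2 * α * ∑ y ∈ G.D, ∑ k ∈ Finset.range (G.L + 1),
      (if G.Top a k y then ((2 : ℝ) ^ k)⁻¹ else 0) * avg k (excess a k) y := by
    rw [Finset.sum_product, Finset.mul_sum]
    refine Finset.sum_congr rfl fun y _ => ?_
    rw [Finset.mul_sum]
    refine Finset.sum_congr rfl fun k _ => ?_
    have : 0 ≤ avg k (excess a k) y := avg_nonneg fun _ _ => le_max_right _ _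
    rw [sub_sub_cancel, max_eq_left (by positivity)]
    split_ifs <;> ring
  rw [h1, h2]
  have h3 := mul_le_mul_of_nonneg_left (G.sum_top_excess_le a) (by positivity : 0 ≤ 2 * α)
  have : (2 : ℝ) ^ (d + 3) = 2 * 2 ^ (d + 2) := by rw [pow_succ _ (d + 2)]; ring
  rw [this]
  linarith

/-- The constant in the discrete estimates. -/
def _root_.DyadicGrid.const (d : ℕ) : ℝ :=
  (1 + 2 * d * ((tau d / 2)⁻¹ + 1)) + 2 * d * 2 ^ (d + 3) + (tau d / 2)⁻¹ + 2 ^ (d + 3)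

lemma _root_.DyadicGrid.const_pos : 0 < const d := by
  have := tau_pos (d := d)
  unfold const
  positivity

lemma tv_nonneg (g : (Fin d → ℤ) → ℝ) : 0 ≤ G.tv g :=
  Finset.sum_nonneg fun _ _ => G.drop_nonneg _ _

/-- The discrete variation bound for the maximal function. -/
theorem tv_maxFun_le (a : (Fin d → ℤ) → ℝ) : G.tv (G.maxFun a) ≤ const d * G.tv a := by
  have hτ := tau_pos (d := d)
  have key := G.sum_mul_max_le_of_sel (s := G.D ×ˢ (Finset.univ : Finset (Fin d × Bool)))
    (c := fun p => if G.E p.1 p.2 then 1 else 0) (u := fun p => G.maxFun a p.1)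
    (v := fun p => G.maxFun a (nb p.1 p.2)) a (fun l k => G.exits a l k)
    (α := 2 * d) (β := 1 + 2 * d * ((tau d / 2)⁻¹ + 1)) (by positivity) (by positivity)
    (fun l x _ k _ => by
      have := G.avg_exits_le_const a l k x
      rw [← div_eq_mul_inv, le_div_iff₀ (by positivity)]
      linarith)
    (fun l x hx k hk h => avg_exits_le hx hk a l (by positivity) h)
    (fun l => by
      rw [Finset.sum_product]
      refine Finset.sum_le_sum fun x hx => ?_
      dsimp only
      by_cases hl : l < G.maxFun a x
      · obtain ⟨k, hk⟩ := exists_sel hl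
        have h1 : ∑ j, (if G.maxFun a (nb x j) ≤ l ∧ l < G.maxFun a x then
            (if G.E x j then (1 : ℝ) else 0) else 0) ≤ G.exits a l k x := by
          refine Finset.sum_le_sum fun j _ => ?_
          by_cases hj : G.maxFun a (nb x j) ≤ l ∧ G.E x j
          · have hn : nb x j ∉ cube k x := by
              intro hmem
              have := avg_le_maxFun (a := a) (G.le_K hx hk.1 hmem)
              rw [avg_eq_of_mem a hmem] at this
              linarith [hk.2.1, hj.1]
            rw [if_pos ⟨hj.1, hl⟩, if_pos hj.2,
              if_pos ⟨hj.2, hn, (le_maxFun a _).trans hj.1⟩]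
          · rw [← ite_and, if_neg (by tauto)]
            split_ifs <;> norm_num
        refine h1.trans ?_
        have := Finset.single_le_sum (s := Finset.range (G.L + 1))
          (f := fun k => if G.Sel a l k x then G.exits a l k x else 0)
          (fun i _ => by
            split_ifs
            · exact Finset.sum_nonneg fun _ _ => by split_ifs <;> norm_num
            · exact le_rfl)
          (Finset.mem_range.2 (Nat.lt_succ_of_le (hk.1.trans (G.K_le x hx))))
        rwa [if_pos hk] at this
      · rw [Finset.sum_eq_zero fun j _ => if_neg fun h => hl h.2]
        refine Finset.sum_nonneg fun k _ => ?_
        split_ifs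
        · exact Finset.sum_nonneg fun _ _ => by split_ifs <;> norm_num
        · exact le_rfl)
  rw [tv_eq]
  refine key.trans (mul_le_mul_of_nonneg_right ?_ (G.tv_nonneg a))
  unfold const
  have : 0 < (tau d / 2)⁻¹ := by positivity
  have : (0 : ℝ) < 2 ^ (d + 3) := by positivity
  linarith

/-- The discrete integral bound for the maximal function. -/
theorem sum_maxFun_sub_le (a : (Fin d → ℤ) → ℝ) :
    ∑ x ∈ G.D, (G.maxFun a x - a x) ≤ const d * 2 ^ G.L * G.tv a := by
  have hτ := tau_pos (d := d)
  have hpow : ∀ x ∈ G.D, ∀ k ≤ G.K x, (2 : ℝ) ^ k ≤ 2 ^ G.L := fun x hx k hk =>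
    pow_le_pow_right₀ (by norm_num) (hk.trans (G.K_le x hx))
  have havg : ∀ l k x, avg k (fun y => 1 - lev a l y) x = 1 - avg k (lev a l) x := by
    intro l k x
    simp only [sub_eq_add_neg]
    rw [avg_add, avg_const, avg_neg]
  have key := G.sum_mul_max_le_of_sel (s := G.D) (c := fun _ => 1) (u := G.maxFun a) (v := a)
    a (fun l k x => 1 - lev a l x)
    (α := 2 ^ G.L) (β := (tau d / 2)⁻¹ * 2 ^ G.L) (by positivity) (by positivity)
    (fun l x hx k hk => by
      rw [havg, ← div_eq_mul_inv, le_div_iff₀ (by positivity)]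
      have h0 : 0 ≤ avg k (lev a l) x := avg_nonneg fun _ _ => lev_nonneg _ _ _
      have := hpow x hx k hk
      have h2 : (0 : ℝ) < 2 ^ k := by positivity
      nlinarith)
    (fun l x hx k hk h => by
      rw [havg]
      have h1 := avg_lev_mul_le hx hk a l
      have h0 : 0 ≤ avg k (G.drop (lev a l)) x := avg_nonneg fun _ _ => G.drop_nonneg _ _
      have h2 : avg k (lev a l) x ≤ 1 := by
        have := avg_mono (k := k) (x := x) fun y _ => lev_le_one a l y
        rwa [avg_const] at this
      have h3 := mul_le_mul_of_nonneg_right (hpow x hx k hk) h0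
      rw [mul_assoc, ← div_eq_inv_mul, le_div_iff₀ (by positivity)]
      nlinarith)
    (fun l => by
      refine Finset.sum_le_sum fun x hx => ?_
      have hnn : ∀ k ∈ Finset.range (G.L + 1),
          0 ≤ if G.Sel a l k x then 1 - lev a l x else 0 := fun k _ => by
        have := lev_le_one a l x
        split_ifs <;> linarith
      by_cases hl : a x ≤ l ∧ l < G.maxFun a x
      · obtain ⟨k, hk⟩ := exists_sel hl.2
        have := Finset.single_le_sum hnn
          (Finset.mem_range.2 (Nat.lt_succ_of_le (hk.1.trans (G.K_le x hx))))
        rw [if_pos hk] at this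
        rw [if_pos hl]
        refine le_trans ?_ this
        rw [lev, if_neg (not_lt.2 hl.1), sub_zero]
      · rw [if_neg hl]
        exact Finset.sum_nonneg hnn)
  have h1 : ∑ x ∈ G.D, (G.maxFun a x - a x) = ∑ x ∈ G.D, 1 * max (G.maxFun a x - a x) 0 := by
    refine Finset.sum_congr rfl fun x _ => ?_
    rw [one_mul, max_eq_left (sub_nonneg.2 (le_maxFun a x))]
  rw [h1]
  refine key.trans (mul_le_mul_of_nonneg_right ?_ (G.tv_nonneg a))
  have : (tau d / 2)⁻¹ * 2 ^ G.L + 2 ^ G.L * 2 ^ (d + 3) =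
    ((tau d / 2)⁻¹ + 2 ^ (d + 3)) * 2 ^ G.L := by ring
  rw [this]
  refine mul_le_mul_of_nonneg_right ?_ (by positivity)
  unfold const
  have : 0 < (tau d / 2)⁻¹ := by positivity
  have : (0 : ℝ) < 2 * d * 2 ^ (d + 3) + (1 + 2 * d * ((tau d / 2)⁻¹ + 1)) := by positivity
  linarith

/-- Averages over admissible cubes are bounded by the values and the variation. -/
theorem avg_sub_le {x : Fin d → ℤ} {k : ℕ} (hx : x ∈ G.D) (hk : k ≤ G.K x)
    (a : (Fin d → ℤ) → ℝ) : avg k a x - a x ≤ G.tv fun y => -a y := by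
  have h1 := sum_sum_sub_le (Nat.zero_le k) x fun y => -a y
  rw [cube_zero, Finset.sum_singleton, pow_zero, one_mul] at h1
  have h2 : ∑ y ∈ cube k x, (a y + -a x) ≤ ∑ y ∈ cube k x, max (-a x - -a y) 0 :=
    Finset.sum_le_sum fun y _ => (by linarith : a y + -a x ≤ -a x - -a y).trans (le_max_left _ _)
  rw [sum_cube_eq, avg_add, avg_const] at h2
  have h3 : ∑ u ∈ cube k x, ∑ j, decr k x (fun y => -a y) j u ≤ G.tv fun y => -a y := by
    refine (Finset.sum_le_sum fun u hu => sum_decr_le_drop hx hk _ hu).trans ?_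
    exact Finset.sum_le_sum_of_subset_of_nonneg (fun y hy => G.mem_D hx hk hy)
      fun y _ _ => G.drop_nonneg _ _
  have h4 : (0 : ℝ) < (2 ^ k) ^ d := by positivity
  have h5 := h2.trans (h1.trans (mul_le_mul_of_nonneg_left h3 h4.le))
  have := le_of_mul_le_mul_left h5 h4
  linarith

end Grid
end

section

variable {d : ℕ}

/-- The dyadic cube with side length `2 ^ n` and index `z`. -/
def cell (n : ℤ) (z : Fin d → ℤ) : Set (Ed d) :=
  {x | ∀ i, x i ∈ Set.Ico ((2 : ℝ) ^ n * z i) ((2 : ℝ) ^ n * (z i + 1))}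

/-- The index of the dyadic cube with side length `2 ^ n` around `x`. -/
def idx (n : ℤ) (x : Ed d) (i : Fin d) : ℤ := ⌊x i / (2 : ℝ) ^ n⌋

lemma two_zpow_pos (n : ℤ) : (0 : ℝ) < 2 ^ n := by positivity

lemma mem_cell {n : ℤ} {z : Fin d → ℤ} {x : Ed d} : x ∈ cell n z ↔ idx n x = z := by
  have h := two_zpow_pos n
  simp only [cell, Set.mem_ofPred_eq, Set.mem_Ico, funext_iff, idx, Int.floor_eq_iff]
  refine forall_congr' fun i => and_congr ?_ ?_
  · rw [le_div_iff₀ h, mul_comm]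
  · rw [div_lt_iff₀ h, mul_comm]

lemma mem_cell_idx (n : ℤ) (x : Ed d) : x ∈ cell n (idx n x) := mem_cell.2 rfl

/-- The index of the dyadic cube `k` generations above the cube with index `z`. -/
def up (k : ℕ) (z : Fin d → ℤ) (i : Fin d) : ℤ := z i / 2 ^ k

lemma mem_cube_iff_up {k : ℕ} {y z : Fin d → ℤ} : y ∈ cube k z ↔ up k y = up k z := by
  rw [mem_cube, funext_iff]
  rfl

lemma up_zero (z : Fin d → ℤ) : up 0 z = z := by
  funext i
  simp [up]

lemma idx_add (n : ℤ) (k : ℕ) (x : Ed d) : idx (n + k) x = up k (idx n x) := by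
  funext i
  have h := Int.floor_div_natCast (x i / (2 : ℝ) ^ n) (2 ^ k)
  push_cast at h
  rw [idx, up, idx, ← h, zpow_add₀ (by norm_num), zpow_natCast, div_div]

lemma cell_subset_up (n : ℤ) (k : ℕ) (z : Fin d → ℤ) : cell n z ⊆ cell (n + k) (up k z) := by
  intro x hx
  rw [mem_cell] at *
  rw [idx_add, hx]

lemma cell_add_eq (n : ℤ) (k : ℕ) (z : Fin d → ℤ) :
    cell (n + k) (up k z) = ⋃ y ∈ cube k z, cell n y := by
  ext x
  simp only [Set.mem_iUnion, mem_cell, exists_prop, idx_add, mem_cube_iff_up]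
  constructor
  · intro h
    exact ⟨_, h, rfl⟩
  · rintro ⟨y, h, rfl⟩
    exact h

lemma disjoint_cell (n : ℤ) {y z : Fin d → ℤ} (h : y ≠ z) : Disjoint (cell n y) (cell n z) := by
  rw [Set.disjoint_left]
  intro x hy hz
  rw [mem_cell] at hy hz
  exact h (hy.symm.trans hz)

lemma cell_eq_preimage (n : ℤ) (z : Fin d → ℤ) : cell n z =
    WithLp.ofLp ⁻¹' (Set.univ.pi fun i => Set.Ico ((2 : ℝ) ^ n * z i) ((2 : ℝ) ^ n * (z i + 1))) := by
  ext x
  simp [cell, Set.mem_pi]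

lemma measurableSet_cell (n : ℤ) (z : Fin d → ℤ) : MeasurableSet (cell n z) := by
  rw [cell_eq_preimage]
  exact (MeasurableSet.univ_pi fun i => measurableSet_Ico).preimage
    (PiLp.volume_preserving_ofLp (Fin d)).measurable

lemma volume_cell (n : ℤ) (z : Fin d → ℤ) :
    volume (cell n z) = ENNReal.ofReal (((2 : ℝ) ^ n) ^ d) := by
  rw [cell_eq_preimage, (PiLp.volume_preserving_ofLp (Fin d)).measure_preimage
    (MeasurableSet.univ_pi fun i => measurableSet_Ico).nullMeasurableSet, Real.volume_pi_Ico]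
  have : ∀ i, (2 : ℝ) ^ n * (z i + 1) - 2 ^ n * z i = 2 ^ n := fun i => by ring
  simp only [this, Finset.prod_const, Finset.card_univ, Fintype.card_fin]
  rw [ENNReal.ofReal_pow (two_zpow_pos n).le]

lemma volume_real_cell (n : ℤ) (z : Fin d → ℤ) : volume.real (cell n z) = ((2 : ℝ) ^ n) ^ d := by
  rw [Measure.real, volume_cell, ENNReal.toReal_ofReal (by positivity)]

lemma norm_le_of_forall_abs_le {v : Ed d} {r : ℝ} (h : ∀ i, |v i| ≤ r) : ‖v‖ ≤ d * r := by
  have h1 : v = ∑ i, EuclideanSpace.single i (v i) := by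
    ext j
    simp [Finset.sum_apply]
  rw [h1]
  refine (norm_sum_le _ _).trans ?_
  calc _ ≤ ∑ _i : Fin d, r := Finset.sum_le_sum fun i _ => by simpa using h i
    _ = _ := by simp

lemma dist_le_of_mem_cell {n : ℤ} {z : Fin d → ℤ} {x y : Ed d} (hx : x ∈ cell n z)
    (hy : y ∈ cell n z) : dist x y ≤ d * 2 ^ n := by
  rw [dist_eq_norm]
  refine norm_le_of_forall_abs_le fun i => ?_
  have h1 := hx i
  have h2 := hy i
  rw [Set.mem_Ico] at h1 h2
  rw [PiLp.sub_apply, abs_le]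
  constructor <;> linarith

lemma isBounded_cell (n : ℤ) (z : Fin d → ℤ) : Bornology.IsBounded (cell n z) :=
  Metric.isBounded_iff.2 ⟨_, fun _ hx _ hy => dist_le_of_mem_cell hx hy⟩

lemma convex_cell (n : ℤ) (z : Fin d → ℤ) : Convex ℝ (cell n z) := by
  intro x hx y hy a b ha hb hab i
  exact convex_Ico ((2 : ℝ) ^ n * z i) _ (hx i) (hy i) ha hb hab

lemma interior_ae_eq (n : ℤ) (z : Fin d → ℤ) : interior (cell n z) =ᵐ[volume] cell n z :=
  interior_ae_eq_of_null_frontier ((convex_cell n z).addHaar_frontier volume)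

variable {Ω : Set (Ed d)} {f : Ed d → ℝ}

lemma cell_ae_le {n : ℤ} {z : Fin d → ℤ} (h : interior (cell n z) ⊆ Ω) :
    cell n z ≤ᵐ[volume] Ω :=
  (interior_ae_eq n z).symm.le.trans (LE.le.eventuallyLE h)

lemma _root_.MemL1TildeLoc.integrableOn_cell (hf : MemL1TildeLoc Ω f) {n : ℤ} {z : Fin d → ℤ}
    (h : interior (cell n z) ⊆ Ω) : IntegrableOn f (cell n z) := by
  have := hf _ h ((isBounded_cell n z).subset interior_subset) isOpen_interior.measurableSet
  exact this.congr_set_ae (interior_ae_eq n z).symm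

/-- The average of `f` over the cube with side length `2 ^ n` and index `z`. -/
def mean (f : Ed d → ℝ) (n : ℤ) (z : Fin d → ℤ) : ℝ := ⨍ x in cell n z, f x

lemma mean_eq (f : Ed d → ℝ) (n : ℤ) (z : Fin d → ℤ) :
    mean f n z = (((2 : ℝ) ^ n) ^ d)⁻¹ * ∫ x in cell n z, f x := by
  rw [mean, setAverage_eq, volume_real_cell, smul_eq_mul]

lemma integral_cell_eq (f : Ed d → ℝ) (n : ℤ) (z : Fin d → ℤ) :
    ∫ x in cell n z, f x = ((2 : ℝ) ^ n) ^ d * mean f n z := by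
  rw [mean_eq]
  have := two_zpow_pos n
  field_simp

lemma avg_mean {n : ℤ} {k : ℕ} {z : Fin d → ℤ} (hf : IntegrableOn f (cell (n + k) (up k z))) :
    avg k (mean f n) z = mean f (n + k) (up k z) := by
  have h1 : ∫ x in cell (n + k) (up k z), f x = ∑ y ∈ cube k z, ∫ x in cell n y, f x := by
    rw [cell_add_eq] at hf ⊢
    refine integral_biUnion_finset _ (fun y _ => measurableSet_cell n y)
      (fun y _ y' _ h => disjoint_cell n h) fun y hy => hf.mono_set ?_
    exact Set.subset_biUnion_of_mem (u := fun y => cell n y) (by exact hy)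
  rw [mean_eq, h1, avg]
  simp only [integral_cell_eq, ← Finset.mul_sum]
  have := two_zpow_pos n
  rw [zpow_add₀ (by norm_num), zpow_natCast, mul_pow]
  field_simp

end

section

open scoped Classical

variable {d : ℕ}

/-- A cube of indices. -/
def box (d L : ℕ) : Finset (Fin d → ℤ) := Fintype.piFinset fun _ => Finset.Ico (-2 ^ L) (2 ^ L)

lemma mem_box {L : ℕ} {z : Fin d → ℤ} : z ∈ box d L ↔ ∀ i, -2 ^ L ≤ z i ∧ z i < 2 ^ L := by
  simp [box]

lemma mem_box_of_mem_cube {k L : ℕ} (hk : k ≤ L) {y z : Fin d → ℤ} (hz : z ∈ box d L)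
    (hy : y ∈ cube k z) : y ∈ box d L := by
  rw [mem_box] at hz ⊢
  rw [mem_cube] at hy
  intro i
  obtain ⟨m, rfl⟩ := Nat.exists_eq_add_of_le hk
  have hp : (0 : ℤ) < 2 ^ k := by positivity
  obtain ⟨h1, h2⟩ := hz i
  have e : (2 : ℤ) ^ (k + m) = 2 ^ m * 2 ^ k := by rw [pow_add, mul_comm]
  rw [e, ← neg_mul] at h1 ⊢
  rw [e] at h2
  exact ⟨(Int.le_ediv_iff_mul_le hp).1 (hy i ▸ (Int.le_ediv_iff_mul_le hp).2 h1),
    (Int.ediv_lt_iff_lt_mul hp).1 (hy i ▸ (Int.ediv_lt_iff_lt_mul hp).2 h2)⟩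

lemma up_add (j k : ℕ) (z : Fin d → ℤ) : up (j + k) z = up k (up j z) := by
  funext i
  simp only [up, pow_add]
  rw [Int.ediv_ediv_of_nonneg (by positivity)]

lemma cell_up_subset (n : ℤ) {j k : ℕ} (h : j ≤ k) (z : Fin d → ℤ) :
    cell (n + j) (up j z) ⊆ cell (n + k) (up k z) := by
  obtain ⟨m, rfl⟩ := Nat.exists_eq_add_of_le h
  rw [up_add]
  push_cast
  rw [← add_assoc]
  exact cell_subset_up _ _ _

/-- The dyadic cubes with side length `2 ^ n` whose interior is contained in `Ω` inside of
`[-2 ^ (n + L), 2 ^ (n + L)) ^ d`. -/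
def cells (Ω : Set (Ed d)) (n : ℤ) (L : ℕ) : Finset (Fin d → ℤ) :=
  {z ∈ box d L | interior (cell n z) ⊆ Ω}

variable {Ω : Set (Ed d)} {n : ℤ} {L : ℕ} {f : Ed d → ℝ}

/-- The largest generation of a dyadic cube above a given one whose interior is contained in `Ω`. -/
def height (Ω : Set (Ed d)) (n : ℤ) (L : ℕ) (z : Fin d → ℤ) : ℕ :=
  Nat.findGreatest (fun k => interior (cell (n + k) (up k z)) ⊆ Ω) L

lemma mem_cells {z : Fin d → ℤ} :
    z ∈ cells Ω n L ↔ z ∈ box d L ∧ interior (cell n z) ⊆ Ω := by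
  simp [cells]

lemma le_height_iff {z : Fin d → ℤ} (hz : z ∈ cells Ω n L) {k : ℕ} :
    k ≤ height Ω n L z ↔ k ≤ L ∧ interior (cell (n + k) (up k z)) ⊆ Ω := by
  rw [mem_cells] at hz
  have h0 : interior (cell (n + (0 : ℕ)) (up 0 z)) ⊆ Ω := by
    rw [up_zero]
    simpa using hz.2
  have h1 : interior (cell (n + (height Ω n L z : ℕ)) (up (height Ω n L z) z)) ⊆ Ω :=
    Nat.findGreatest_spec (P := fun k => interior (cell (n + (k : ℕ)) (up k z)) ⊆ Ω)
      (Nat.zero_le L) h0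
  constructor
  · intro h
    exact ⟨h.trans (Nat.findGreatest_le L), (interior_mono (cell_up_subset n h z)).trans h1⟩
  · rintro ⟨h, h'⟩
    exact Nat.le_findGreatest h h'

lemma mem_cells_of_mem_cube {x y : Fin d → ℤ} {k : ℕ} (hx : x ∈ cells Ω n L)
    (hk : k ≤ height Ω n L x) (hy : y ∈ cube k x) : y ∈ cells Ω n L := by
  rw [le_height_iff hx] at hk
  rw [mem_cells] at hx ⊢
  refine ⟨mem_box_of_mem_cube hk.1 hx.1 hy, (interior_mono ?_).trans hk.2⟩
  rw [← mem_cube_iff_up.1 hy]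
  exact cell_subset_up n k y

/-- The grid of dyadic cubes inside `Ω`. -/
def grid (Ω : Set (Ed d)) (n : ℤ) (L : ℕ) : Grid d where
  D := cells Ω n L
  L := L
  K := height Ω n L
  E z j := z ∈ cells Ω n L ∧ nb z j ∈ cells Ω n L ∧ interior (cell n z ∪ cell n (nb z j)) ⊆ Ω
  K_le _ _ := Nat.findGreatest_le L
  mem_D hx hk hy := mem_cells_of_mem_cube hx hk hy
  le_K hx hk hy := by
    have hy' := mem_cells_of_mem_cube hx hk hy
    rw [le_height_iff hx] at hk
    rw [le_height_iff hy', mem_cube_iff_up.1 hy]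
    exact hk
  E_mem _ h := h.2.1
  E_cube {x k u j} hx hk hu hn := by
    refine ⟨mem_cells_of_mem_cube hx hk hu, mem_cells_of_mem_cube hx hk hn, ?_⟩
    rw [le_height_iff hx] at hk
    refine (interior_mono (Set.union_subset ?_ ?_)).trans hk.2
    · rw [← mem_cube_iff_up.1 hu]
      exact cell_subset_up n k u
    · rw [← mem_cube_iff_up.1 hn]
      exact cell_subset_up n k _

lemma mean_le_maxFun (hf : MemL1TildeLoc Ω f) {z : Fin d → ℤ} (hz : z ∈ cells Ω n L) {k : ℕ}
    (hk : k ≤ L) (h : interior (cell (n + k) (up k z)) ⊆ Ω) :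
    mean f (n + k) (up k z) ≤ (grid Ω n L).maxFun (mean f n) z := by
  rw [← avg_mean (hf.integrableOn_cell h)]
  exact Grid.avg_le_maxFun (G := grid Ω n L) ((le_height_iff hz).2 ⟨hk, h⟩)

lemma exists_maxFun_eq (hf : MemL1TildeLoc Ω f) {z : Fin d → ℤ} (hz : z ∈ cells Ω n L) :
    ∃ k ≤ L, interior (cell (n + (k : ℕ)) (up k z)) ⊆ Ω ∧
      (grid Ω n L).maxFun (mean f n) z = mean f (n + k) (up k z) := by
  obtain ⟨k, hk, h⟩ := Finset.exists_mem_eq_sup'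
    (Finset.nonempty_range_add_one (n := (grid Ω n L).K z)) fun k => avg k (mean f n) z
  rw [Finset.mem_range, Nat.lt_succ_iff] at hk
  obtain ⟨h1, h2⟩ := (le_height_iff hz).1 hk
  exact ⟨k, h1, h2, h.trans (avg_mean (hf.integrableOn_cell h2))⟩

lemma nb_nb (z : Fin d → ℤ) (i : Fin d) (b : Bool) : nb (nb z (i, b)) (i, !b) = z := by
  funext j
  by_cases h : j = i
  · subst h
    cases b <;> simp [nb]
  · simp [nb, h]

lemma nb_true_nb_false (z : Fin d → ℤ) (i : Fin d) : nb (nb z (i, false)) (i, true) = z :=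
  nb_nb z i false

lemma nb_false_nb_true (z : Fin d → ℤ) (i : Fin d) : nb (nb z (i, true)) (i, false) = z :=
  nb_nb z i true

/-- Every edge is counted once in each direction. -/
lemma tv_grid_eq (g : (Fin d → ℤ) → ℝ) : (grid Ω n L).tv g = ∑ i : Fin d, ∑ z ∈ cells Ω n L,
    if (grid Ω n L).E z (i, true) then |g z - g (nb z (i, true))| else 0 := by
  have h : ∀ i, ∑ z ∈ cells Ω n L, (if (grid Ω n L).E z (i, false) then
      max (g z - g (nb z (i, false))) 0 else 0) = ∑ z ∈ cells Ω n L,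
      if (grid Ω n L).E z (i, true) then max (g (nb z (i, true)) - g z) 0 else 0 := by
    intro i
    rw [← Finset.sum_filter, ← Finset.sum_filter]
    refine Finset.sum_nbij' (fun z => nb z (i, false)) (fun z => nb z (i, true)) ?_ ?_ ?_ ?_ ?_
    · intro z hz
      rw [Finset.mem_filter] at hz ⊢
      obtain ⟨h1, h2, h3, h4⟩ := hz
      refine ⟨h3, h3, ?_⟩
      rw [nb_true_nb_false, Set.union_comm]
      exact ⟨h1, h4⟩
    · intro z hz
      rw [Finset.mem_filter] at hz ⊢
      obtain ⟨h1, h2, h3, h4⟩ := hz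
      refine ⟨h3, h3, ?_⟩
      rw [nb_false_nb_true, Set.union_comm]
      exact ⟨h1, h4⟩
    · exact fun z _ => nb_nb z i false
    · exact fun z _ => nb_nb z i true
    · intro z _
      rw [nb_true_nb_false]
  unfold Grid.tv Grid.drop
  simp only [Fintype.sum_prod_type, Fintype.sum_bool]
  rw [Finset.sum_comm]
  refine Finset.sum_congr rfl fun i _ => ?_
  rw [Finset.sum_add_distrib]
  refine (congrArg _ (h i)).trans ?_
  refine Finset.sum_add_distrib.symm.trans (Finset.sum_congr rfl fun z _ => ?_)
  split_ifs
  · rcases le_total (g z) (g (nb z (i, true))) with h' | h'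
    · rw [max_eq_right (by linarith), max_eq_left (by linarith), abs_of_nonpos (by linarith)]
      ring
    · rw [max_eq_left (by linarith), max_eq_right (by linarith), abs_of_nonneg (by linarith)]
      ring
  · simp

lemma tv_grid_neg (g : (Fin d → ℤ) → ℝ) :
    (grid Ω n L).tv (fun z => -g z) = (grid Ω n L).tv g := by
  rw [tv_grid_eq, tv_grid_eq]
  refine Finset.sum_congr rfl fun i _ => Finset.sum_congr rfl fun z _ => ?_
  rw [neg_sub_neg, abs_sub_comm]

end

section

variable {d : ℕ}

/-- Smooth approximations of the indicator function of `(0, 1)`. -/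
def chi (m : ℕ) (t : ℝ) : ℝ := (m * t - 1).smoothTransition * (m * (1 - t) - 1).smoothTransition

lemma chi_nonneg (m : ℕ) (t : ℝ) : 0 ≤ chi m t :=
  mul_nonneg (Real.smoothTransition.nonneg _) (Real.smoothTransition.nonneg _)

lemma chi_le_one (m : ℕ) (t : ℝ) : chi m t ≤ 1 :=
  mul_le_one₀ (Real.smoothTransition.le_one _) (Real.smoothTransition.nonneg _)
    (Real.smoothTransition.le_one _)

lemma contDiff_chi (m : ℕ) : ContDiff ℝ 1 (chi m) := by
  unfold chi
  exact (Real.smoothTransition.contDiff.comp (by fun_prop)).mul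
    (Real.smoothTransition.contDiff.comp (by fun_prop))

lemma chi_eq_zero_left {m : ℕ} {t : ℝ} (h : m * t ≤ 1) : chi m t = 0 := by
  rw [chi, Real.smoothTransition.zero_of_nonpos (by linarith), zero_mul]

lemma chi_eq_zero_right {m : ℕ} {t : ℝ} (h : m * (1 - t) ≤ 1) : chi m t = 0 := by
  rw [chi, Real.smoothTransition.zero_of_nonpos (x := m * (1 - t) - 1) (by linarith), mul_zero]

lemma mem_Ioo_of_chi_ne_zero {m : ℕ} {t : ℝ} (h : chi m t ≠ 0) : t ∈ Set.Ioo (0 : ℝ) 1 := by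
  have hm : (0 : ℝ) ≤ m := Nat.cast_nonneg m
  constructor
  · by_contra! ht
    exact h (chi_eq_zero_left (by nlinarith))
  · by_contra! ht
    exact h (chi_eq_zero_right (by nlinarith))

lemma tendsto_chi {t : ℝ} (ht : t ∈ Set.Ioo (0 : ℝ) 1) :
    Tendsto (fun m : ℕ => chi m t) atTop (𝓝 1) := by
  refine tendsto_const_nhds.congr' ?_
  have h1 : Tendsto (fun m : ℕ => (m : ℝ) * t) atTop atTop :=
    tendsto_natCast_atTop_atTop.atTop_mul_const ht.1
  have h2 : Tendsto (fun m : ℕ => (m : ℝ) * (1 - t)) atTop atTop :=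
    tendsto_natCast_atTop_atTop.atTop_mul_const (by linarith [ht.2])
  filter_upwards [h1.eventually_ge_atTop 2, h2.eventually_ge_atTop 2] with m h1 h2
  rw [chi, Real.smoothTransition.one_of_one_le (by linarith),
    Real.smoothTransition.one_of_one_le (by linarith), one_mul]

/-- A primitive of `chi m t - chi m (t - 1)`. -/
def hat (m : ℕ) (t : ℝ) : ℝ := ∫ s in (t - 1)..t, chi m s

lemma hasDerivAt_hat (m : ℕ) (t : ℝ) : HasDerivAt (hat m) (chi m t - chi m (t - 1)) t := by
  have hc := (contDiff_chi m).continuous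
  have h1 : ∀ t, HasDerivAt (fun t => ∫ s in (0 : ℝ)..t, chi m s) (chi m t) t := fun t =>
    intervalIntegral.integral_hasDerivAt_right (hc.intervalIntegrable _ _)
      (hc.stronglyMeasurableAtFilter _ _) hc.continuousAt
  have h2 : HasDerivAt (fun t => ∫ s in (0 : ℝ)..(t - 1), chi m s) (chi m (t - 1)) t :=
    (h1 (t - 1)).comp_sub_const t 1
  have h3 : hat m = fun t => (∫ s in (0 : ℝ)..t, chi m s) - ∫ s in (0 : ℝ)..(t - 1), chi m s := by
    funext t
    rw [hat, intervalIntegral.integral_interval_sub_left (hc.intervalIntegrable _ _)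
      (hc.intervalIntegrable _ _)]
  rw [h3]
  exact (h1 t).sub h2

lemma contDiff_hat (m : ℕ) : ContDiff ℝ 1 (hat m) := by
  rw [contDiff_one_iff_deriv]
  refine ⟨fun t => (hasDerivAt_hat m t).differentiableAt, ?_⟩
  have : deriv (hat m) = fun t => chi m t - chi m (t - 1) :=
    funext fun t => (hasDerivAt_hat m t).deriv
  rw [this]
  have := (contDiff_chi m).continuous
  fun_prop

lemma hat_nonneg (m : ℕ) (t : ℝ) : 0 ≤ hat m t :=
  intervalIntegral.integral_nonneg (by linarith) fun s _ => chi_nonneg m s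

lemma hat_le_one (m : ℕ) (t : ℝ) : hat m t ≤ 1 := by
  have hc := (contDiff_chi m).continuous
  have := intervalIntegral.integral_mono_on (a := t - 1) (b := t) (μ := volume) (by linarith)
    (hc.intervalIntegrable _ _) (intervalIntegrable_const (μ := volume) (c := 1))
    fun s _ => chi_le_one m s
  simpa [hat] using this

lemma hat_eq_zero_left {m : ℕ} {t : ℝ} (h : m * t ≤ 1) : hat m t = 0 := by
  have hm : (0 : ℝ) ≤ m := Nat.cast_nonneg m
  rw [hat, intervalIntegral.integral_congr (g := fun _ => 0), intervalIntegral.integral_zero]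
  intro s hs
  rw [Set.uIcc_of_le (by linarith)] at hs
  exact chi_eq_zero_left (by nlinarith [hs.2])

lemma hat_eq_zero_right {m : ℕ} {t : ℝ} (h : m * (2 - t) ≤ 1) : hat m t = 0 := by
  have hm : (0 : ℝ) ≤ m := Nat.cast_nonneg m
  rw [hat, intervalIntegral.integral_congr (g := fun _ => 0), intervalIntegral.integral_zero]
  intro s hs
  rw [Set.uIcc_of_le (by linarith)] at hs
  exact chi_eq_zero_right (by nlinarith [hs.1])

/-- Smooth approximations of the indicator function of a dyadic cube. -/
def smoothCell (m : ℕ) (n : ℤ) (z : Fin d → ℤ) (x : Ed d) : ℝ :=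
  ∏ j, chi m (x j / 2 ^ n - z j)

/-- Functions whose derivative in direction `i` approximates the difference of the indicator
functions of two adjacent dyadic cubes. -/
def bump (m : ℕ) (n : ℤ) (i : Fin d) (z : Fin d → ℤ) (x : Ed d) : ℝ :=
  (∏ j ∈ Finset.univ.erase i, chi m (x j / 2 ^ n - z j)) * hat m (x i / 2 ^ n - z i)

lemma contDiff_bump (m : ℕ) (n : ℤ) (i : Fin d) (z : Fin d → ℤ) :
    ContDiff ℝ 1 (bump m n i z) := by
  unfold bump
  refine ContDiff.mul (contDiff_prod fun j _ => (contDiff_chi m).comp ?_)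
    ((contDiff_hat m).comp ?_) <;> fun_prop

lemma fderiv_bump (m : ℕ) (n : ℤ) (i : Fin d) (z : Fin d → ℤ) (x : Ed d) :
    fderiv ℝ (bump m n i z) x (EuclideanSpace.single i 1) =
      ((2 : ℝ) ^ n)⁻¹ * (smoothCell m n z x - smoothCell m n (nb z (i, true)) x) := by
  rw [← ((contDiff_bump m n i z).differentiable one_ne_zero x).lineDeriv_eq_fderiv, lineDeriv]
  have h1 : ∀ t : ℝ, bump m n i z (x + t • EuclideanSpace.single i 1) =
      (∏ j ∈ Finset.univ.erase i, chi m (x j / 2 ^ n - z j)) *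
        hat m ((x i + t) / 2 ^ n - z i) := by
    intro t
    unfold bump
    congr 1
    · refine Finset.prod_congr rfl fun j hj => ?_
      simp [Finset.ne_of_mem_erase hj]
    · simp
  simp only [h1]
  have h2 : HasDerivAt (fun t : ℝ => (x i + t) / 2 ^ n - z i) (((2 : ℝ) ^ n)⁻¹) 0 := by
    have := (((hasDerivAt_id (0 : ℝ)).const_add (x i)).div_const ((2 : ℝ) ^ n)).sub_const (z i : ℝ)
    simpa using this
  have h3 := ((hasDerivAt_hat m ((x i + 0) / 2 ^ n - z i)).comp (0 : ℝ) h2).const_mul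
    (∏ j ∈ Finset.univ.erase i, chi m (x j / 2 ^ n - z j))
  refine h3.deriv.trans ?_
  unfold smoothCell
  rw [← Finset.mul_prod_erase Finset.univ _ (Finset.mem_univ i),
    ← Finset.mul_prod_erase Finset.univ (fun j => chi m (x j / 2 ^ n - (nb z (i, true) j : ℤ)))
      (Finset.mem_univ i)]
  have h4 : ∏ j ∈ Finset.univ.erase i, chi m (x j / 2 ^ n - (nb z (i, true) j : ℤ)) =
      ∏ j ∈ Finset.univ.erase i, chi m (x j / 2 ^ n - z j) := by
    refine Finset.prod_congr rfl fun j hj => ?_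
    simp [nb, Finset.ne_of_mem_erase hj]
  have h5 : ((nb z (i, true) i : ℤ) : ℝ) = z i + 1 := by simp [nb]
  rw [h4, h5, add_zero, sub_sub]
  ring

lemma abs_bump_le_one (m : ℕ) (n : ℤ) (i : Fin d) (z : Fin d → ℤ) (x : Ed d) :
    |bump m n i z x| ≤ 1 := by
  have h0 : 0 ≤ ∏ j ∈ Finset.univ.erase i, chi m (x j / 2 ^ n - z j) :=
    Finset.prod_nonneg fun j _ => chi_nonneg _ _
  rw [bump, abs_of_nonneg (mul_nonneg h0 (hat_nonneg _ _))]
  exact mul_le_one₀ (Finset.prod_le_one (fun j _ => chi_nonneg _ _) fun j _ => chi_le_one _ _)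
    (hat_nonneg _ _) (hat_le_one _ _)

lemma interior_cell (n : ℤ) (z : Fin d → ℤ) : interior (cell n z) =
    {x : Ed d | ∀ i, x i / (2 : ℝ) ^ n - (z i : ℝ) ∈ Set.Ioo (0 : ℝ) 1} := by
  have h := (PiLp.homeomorph 2 (fun _ : Fin d => ℝ)).preimage_interior
    (Set.univ.pi fun i => Set.Ico ((2 : ℝ) ^ n * z i) ((2 : ℝ) ^ n * (z i + 1)))
  rw [cell_eq_preimage]
  refine h.symm.trans ?_
  rw [interior_pi_set Set.finite_univ]
  ext x
  have h2 := two_zpow_pos n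
  simp only [interior_Ico, Set.mem_preimage, Set.mem_pi, Set.mem_univ, true_imp_iff, Set.mem_Ioo,
    Set.mem_ofPred_eq]
  refine forall_congr' fun i => and_congr ?_ ?_
  · rw [sub_pos, lt_div_iff₀ h2, mul_comm]; rfl
  · rw [sub_lt_iff_lt_add, div_lt_iff₀ h2, mul_comm, add_comm]; rfl

/-- The interior of the union of two adjacent dyadic cubes. -/
lemma mem_interior_union {n : ℤ} {z : Fin d → ℤ} {i : Fin d} {x : Ed d}
    (h : ∀ j ≠ i, x j / 2 ^ n - z j ∈ Set.Ioo (0 : ℝ) 1)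
    (hi : x i / 2 ^ n - z i ∈ Set.Ioo (0 : ℝ) 2) :
    x ∈ interior (cell n z ∪ cell n (nb z (i, true))) := by
  set O : Set (Ed d) := {x | (∀ j, j ≠ i → x j / 2 ^ n - z j ∈ Set.Ioo (0 : ℝ) 1) ∧
    x i / 2 ^ n - z i ∈ Set.Ioo (0 : ℝ) 2} with hO
  have hopen : IsOpen O := by
    have : O = (⋂ j, ⋂ _ : j ≠ i, (fun x : Ed d => x j / 2 ^ n - z j) ⁻¹' Set.Ioo (0 : ℝ) 1) ∩
        (fun x : Ed d => x i / 2 ^ n - z i) ⁻¹' Set.Ioo (0 : ℝ) 2 := by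
      ext x
      simp [hO]
    rw [this]
    refine IsOpen.inter (isOpen_iInter_of_finite fun j => isOpen_iInter_of_finite fun _ =>
      isOpen_Ioo.preimage ?_) (isOpen_Ioo.preimage ?_) <;> fun_prop
  refine interior_maximal ?_ hopen ⟨h, hi⟩
  rintro y ⟨h1, h2⟩
  have hj : ∀ j, j ≠ i → ⌊y j / (2 : ℝ) ^ n⌋ = z j := fun j hj => by
    rw [Int.floor_eq_iff]
    constructor <;> linarith [(h1 j hj).1, (h1 j hj).2]
  rcases lt_or_ge (y i / 2 ^ n - z i) 1 with hlt | hge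
  · left
    rw [mem_cell]
    funext j
    by_cases hji : j = i
    · subst hji
      rw [idx, Int.floor_eq_iff]
      constructor <;> linarith [h2.1]
    · exact hj j hji
  · right
    rw [mem_cell]
    funext j
    by_cases hji : j = i
    · subst hji
      rw [idx, Int.floor_eq_iff]
      simp only [nb, Function.update_self, if_true]
      push_cast
      constructor <;> linarith [h2.2]
    · rw [idx, hj j hji]
      simp [nb, hji]

lemma of_bump_ne_zero {m : ℕ} {n : ℤ} {i : Fin d} {z : Fin d → ℤ} {x : Ed d}
    (h : bump m n i z x ≠ 0) :
    (∀ j, j ≠ i → 1 ≤ m * (x j / 2 ^ n - z j) ∧ 1 ≤ m * (1 - (x j / 2 ^ n - z j))) ∧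
      1 ≤ m * (x i / 2 ^ n - z i) ∧ 1 ≤ m * (2 - (x i / 2 ^ n - z i)) := by
  rw [bump] at h
  have h1 := left_ne_zero_of_mul h
  have h2 := right_ne_zero_of_mul h
  rw [Finset.prod_ne_zero_iff] at h1
  refine ⟨fun j hj => ?_, ?_, ?_⟩
  · have h3 := h1 j (Finset.mem_erase.2 ⟨hj, Finset.mem_univ j⟩)
    constructor <;> by_contra! hc
    · exact h3 (chi_eq_zero_left hc.le)
    · exact h3 (chi_eq_zero_right hc.le)
  · by_contra! hc
    exact h2 (hat_eq_zero_left hc.le)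
  · by_contra! hc
    exact h2 (hat_eq_zero_right hc.le)

lemma tsupport_bump_subset (m : ℕ) (n : ℤ) (i : Fin d) (z : Fin d → ℤ) :
    tsupport (bump m n i z) ⊆ interior (cell n z ∪ cell n (nb z (i, true))) := by
  have hclosed : IsClosed {x : Ed d | (∀ j, j ≠ i → 1 ≤ m * (x j / 2 ^ n - z j) ∧
      1 ≤ m * (1 - (x j / 2 ^ n - z j))) ∧
      1 ≤ m * (x i / 2 ^ n - z i) ∧ 1 ≤ m * (2 - (x i / 2 ^ n - z i))} := by
    simp only [Set.ofPred_and, Set.ofPred_forall]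
    refine IsClosed.inter (isClosed_iInter fun j => isClosed_iInter fun _ => IsClosed.inter ?_ ?_)
      (IsClosed.inter ?_ ?_) <;> exact isClosed_le (by fun_prop) (by fun_prop)
  refine (closure_minimal (fun x hx => of_bump_ne_zero hx) hclosed).trans ?_
  rintro x ⟨h1, h2, h3⟩
  have hm : (0 : ℝ) ≤ m := Nat.cast_nonneg m
  have pos : ∀ {t : ℝ}, 1 ≤ m * t → 0 < t := fun {t} h => by
    by_contra! ht
    nlinarith
  refine mem_interior_union (fun j hj => ⟨pos (h1 j hj).1, ?_⟩) ⟨pos h2, ?_⟩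
  · linarith [pos (h1 j hj).2]
  · linarith [pos h3]

end

section

variable {d : ℕ}

lemma divergence_smul_single {g : Ed d → ℝ} {x : Ed d} (hg : DifferentiableAt ℝ g x) (i : Fin d) :
    divergence (fun y => g y • EuclideanSpace.single i (1 : ℝ)) x =
      fderiv ℝ g x (EuclideanSpace.single i 1) := by
  rw [divergence, fderiv_smul_const hg]
  simp [ContinuousLinearMap.smulRight_apply]

variable {Ω : Set (Ed d)} {f : Ed d → ℝ}

lemma integral_mul_divergence_le (hv : var Ω f < ∞) {φ : Ed d → Ed d} (h1 : ContDiff ℝ 1 φ)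
    (h2 : HasCompactSupport φ) (h3 : tsupport φ ⊆ Ω) (h4 : ∀ x, ‖φ x‖ ≤ 1) :
    ∫ x in Ω, f x * divergence φ x ≤ (var Ω f).toReal := by
  rw [← ENNReal.ofReal_le_iff_le_toReal hv.ne]
  exact le_iSup₂_of_le (f := fun φ _ => ENNReal.ofReal (∫ x in Ω, f x * divergence φ x)) φ
    ⟨h1, h2, h3, h4⟩ le_rfl

lemma mem_interior_of_smoothCell_ne_zero {m : ℕ} {n : ℤ} {z : Fin d → ℤ} {x : Ed d}
    (h : smoothCell m n z x ≠ 0) : x ∈ interior (cell n z) := by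
  rw [interior_cell]
  intro i
  rw [smoothCell, Finset.prod_ne_zero_iff] at h
  exact mem_Ioo_of_chi_ne_zero (h i (Finset.mem_univ i))

lemma smoothCell_nonneg (m : ℕ) (n : ℤ) (z : Fin d → ℤ) (x : Ed d) : 0 ≤ smoothCell m n z x :=
  Finset.prod_nonneg fun _ _ => chi_nonneg _ _

lemma smoothCell_le_one (m : ℕ) (n : ℤ) (z : Fin d → ℤ) (x : Ed d) : smoothCell m n z x ≤ 1 :=
  Finset.prod_le_one (fun _ _ => chi_nonneg _ _) fun _ _ => chi_le_one _ _

lemma continuous_smoothCell (m : ℕ) (n : ℤ) (z : Fin d → ℤ) : Continuous (smoothCell m n z) := by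
  unfold smoothCell
  refine continuous_finsetProd _ fun j _ => (contDiff_chi m).continuous.comp ?_
  fun_prop

lemma mul_smoothCell_eq_indicator (m : ℕ) (n : ℤ) (z : Fin d → ℤ) :
    (fun x => f x * smoothCell m n z x) =
      (interior (cell n z)).indicator fun x => f x * smoothCell m n z x := by
  funext x
  by_cases h : x ∈ interior (cell n z)
  · rw [Set.indicator_of_mem h]
  · rw [Set.indicator_of_notMem h, by_contra fun h' => h (mem_interior_of_smoothCell_ne_zero h'),
      mul_zero]

lemma integrable_mul_smoothCell (hf : MemL1TildeLoc Ω f) {n : ℤ} {z : Fin d → ℤ}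
    (h : interior (cell n z) ⊆ Ω) (m : ℕ) : Integrable (fun x => f x * smoothCell m n z x) := by
  rw [mul_smoothCell_eq_indicator, integrable_indicator_iff isOpen_interior.measurableSet]
  have := (hf.integrableOn_cell h).mono_set interior_subset
  refine Integrable.mul_bdd (c := 1) this (continuous_smoothCell m n z).aestronglyMeasurable ?_
  refine Eventually.of_forall fun x => ?_
  rw [Real.norm_eq_abs, abs_of_nonneg (smoothCell_nonneg _ _ _ _)]
  exact smoothCell_le_one _ _ _ _

lemma tendsto_integral_mul_smoothCell (hΩ : MeasurableSet Ω) (hf : MemL1TildeLoc Ω f) {n : ℤ}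
    {z : Fin d → ℤ} (h : interior (cell n z) ⊆ Ω) :
    Tendsto (fun m => ∫ x in Ω, f x * smoothCell m n z x) atTop (𝓝 (∫ x in cell n z, f x)) := by
  have h1 : ∀ m, ∫ x in Ω, f x * smoothCell m n z x =
      ∫ x in interior (cell n z), f x * smoothCell m n z x := by
    intro m
    refine setIntegral_eq_of_subset_of_forall_sdiff_eq_zero hΩ h fun x hx => ?_
    rw [by_contra fun h' => hx.2 (mem_interior_of_smoothCell_ne_zero h'), mul_zero]
  simp_rw [h1]
  rw [← setIntegral_congr_set (interior_ae_eq n z)]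
  have hfi := (hf.integrableOn_cell h).mono_set interior_subset
  refine tendsto_integral_of_dominated_convergence (fun x => ‖f x‖) (fun m => ?_) hfi.norm
    (fun m => Eventually.of_forall fun x => ?_) ?_
  · exact hfi.aestronglyMeasurable.mul (continuous_smoothCell m n z).aestronglyMeasurable
  · rw [norm_mul, Real.norm_eq_abs (smoothCell _ _ _ _), abs_of_nonneg (smoothCell_nonneg _ _ _ _)]
    exact mul_le_of_le_one_right (norm_nonneg _) (smoothCell_le_one _ _ _ _)
  · refine (ae_restrict_iff' isOpen_interior.measurableSet).2 (Eventually.of_forall fun x hx => ?_)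
    rw [interior_cell] at hx
    have : Tendsto (fun m => smoothCell m n z x) atTop (𝓝 (∏ _j : Fin d, 1)) :=
      tendsto_finsetProd _ fun j _ => tendsto_chi (hx j)
    simpa using this.const_mul (f x)

lemma hasCompactSupport_bump (m : ℕ) (n : ℤ) (i : Fin d) (z : Fin d → ℤ) :
    IsCompact (tsupport (bump m n i z)) :=
  Metric.isCompact_of_isClosed_isBounded (isClosed_tsupport _)
    (((isBounded_cell n z).union (isBounded_cell n _)).subset
      ((tsupport_bump_subset m n i z).trans interior_subset))

lemma sum_abs_bump_le (m : ℕ) (n : ℤ) (i : Fin d) (S : Finset (Fin d → ℤ)) (x : Ed d) :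
    ∑ w ∈ S, |bump m n i w x| ≤ 2 := by
  classical
  have h1 : ∀ w, bump m n i w x ≠ 0 → w ∈ ({idx n x, nb (idx n x) (i, false)} : Finset _) := by
    intro w hw
    rw [Finset.mem_insert, Finset.mem_singleton]
    rcases interior_subset (tsupport_bump_subset m n i w (subset_tsupport _ hw)) with h | h
    · exact Or.inl (mem_cell.1 h).symm
    · right
      rw [mem_cell.1 h, nb_false_nb_true]
  calc ∑ w ∈ S, |bump m n i w x|
      ≤ ∑ w ∈ ({idx n x, nb (idx n x) (i, false)} : Finset _), |bump m n i w x| := by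
        rw [← Finset.sum_filter_ne_zero]
        exact Finset.sum_le_sum_of_subset_of_nonneg
          (fun w hw => h1 w (abs_ne_zero.1 (Finset.mem_filter.1 hw).2)) fun _ _ _ => abs_nonneg _
    _ ≤ ∑ w ∈ ({idx n x, nb (idx n x) (i, false)} : Finset (Fin d → ℤ)), (1 : ℝ) :=
        Finset.sum_le_sum fun w _ => abs_bump_le_one m n i w x
    _ ≤ 2 := by
        rw [Finset.sum_const, nsmul_one]
        exact_mod_cast Finset.card_le_two

/-- The variation of a function controls the differences between its means over adjacent
cubes. -/
lemma sum_abs_mean_sub_le (hΩ : MeasurableSet Ω) (hf : MemL1TildeLoc Ω f) (hv : var Ω f < ∞)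
    (n : ℤ) (i : Fin d) (S : Finset (Fin d → ℤ))
    (hS : ∀ w ∈ S, interior (cell n w ∪ cell n (nb w (i, true))) ⊆ Ω) :
    ((2 : ℝ) ^ n) ^ d * ∑ w ∈ S, |mean f n w - mean f n (nb w (i, true))| ≤
      2 * 2 ^ n * (var Ω f).toReal := by
  classical
  have hp := two_zpow_pos n
  set s : (Fin d → ℤ) → ℝ := fun w => SignType.sign (mean f n w - mean f n (nb w (i, true)))
    with hs
  have hs1 : ∀ w, |s w| ≤ 1 := fun w => by
    rcases lt_trichotomy (mean f n w - mean f n (nb w (i, true))) 0 with h | h | h <;> simp [hs, h]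
  have hcell : ∀ w ∈ S, interior (cell n w) ⊆ Ω := fun w hw =>
    (interior_mono Set.subset_union_left).trans (hS w hw)
  have hcell' : ∀ w ∈ S, interior (cell n (nb w (i, true))) ⊆ Ω := fun w hw =>
    (interior_mono Set.subset_union_right).trans (hS w hw)
  have key : ∀ m : ℕ, ∑ w ∈ S, s w * ((2 * (2 : ℝ) ^ n)⁻¹ * ((∫ x in Ω, f x * smoothCell m n w x) -
      ∫ x in Ω, f x * smoothCell m n (nb w (i, true)) x)) ≤ (var Ω f).toReal := by
    intro m
    set g : Ed d → ℝ := fun x => ∑ w ∈ S, s w / 2 * bump m n i w x with hg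
    have hgd : ContDiff ℝ 1 g := ContDiff.sum fun w _ => contDiff_const.mul (contDiff_bump m n i w)
    have hgder : ∀ x, fderiv ℝ g x (EuclideanSpace.single i 1) = ∑ w ∈ S, s w / 2 *
        (((2 : ℝ) ^ n)⁻¹ * (smoothCell m n w x - smoothCell m n (nb w (i, true)) x)) := by
      intro x
      have hb : ∀ w, DifferentiableAt ℝ (bump m n i w) x := fun w =>
        (contDiff_bump m n i w).differentiable one_ne_zero x
      rw [hg, fderiv_fun_sum fun w _ => (hb w).const_mul _, sum_apply]
      refine Finset.sum_congr rfl fun w _ => ?_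
      rw [fderiv_const_mul (hb w), smul_apply, fderiv_bump, smul_eq_mul]
    set φ : Ed d → Ed d := fun x => g x • EuclideanSpace.single i (1 : ℝ) with hφ
    set T : Set (Ed d) := ⋃ w ∈ S, tsupport (bump m n i w) with hT
    have hTc : IsCompact T := S.isCompact_biUnion fun w _ => hasCompactSupport_bump m n i w
    have hsupp : Function.support φ ⊆ T := by
      intro x hx
      by_contra hxT
      refine hx ?_
      rw [hφ]
      have : g x = 0 := Finset.sum_eq_zero fun w hw => by
        have : x ∉ tsupport (bump m n i w) := fun h => hxT (Set.mem_biUnion (x := w) hw h)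
        rw [image_eq_zero_of_notMem_tsupport this, mul_zero]
      simp [this]
    have := integral_mul_divergence_le (φ := φ) hv (hgd.smul contDiff_const)
      (HasCompactSupport.of_support_subset_isCompact hTc hsupp)
      ((closure_minimal hsupp hTc.isClosed).trans (Set.iUnion₂_subset fun w hw =>
        (tsupport_bump_subset m n i w).trans (hS w hw))) ?_
    · refine le_of_eq_of_le ?_ this
      have e : ∀ x, f x * divergence φ x = ∑ w ∈ S, (s w * (2 * (2 : ℝ) ^ n)⁻¹ *
          (f x * smoothCell m n w x) - s w * (2 * (2 : ℝ) ^ n)⁻¹ *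
          (f x * smoothCell m n (nb w (i, true)) x)) := by
        intro x
        rw [hφ, divergence_smul_single (hgd.differentiable one_ne_zero x), hgder, Finset.mul_sum]
        refine Finset.sum_congr rfl fun w _ => ?_
        rw [mul_inv]
        ring
      simp_rw [e]
      have i1 : ∀ w ∈ S, IntegrableOn (fun x => s w * (2 * (2 : ℝ) ^ n)⁻¹ *
          (f x * smoothCell m n w x)) Ω := fun w hw =>
        ((integrable_mul_smoothCell hf (hcell w hw) m).const_mul _).integrableOn
      have i2 : ∀ w ∈ S, IntegrableOn (fun x => s w * (2 * (2 : ℝ) ^ n)⁻¹ *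
          (f x * smoothCell m n (nb w (i, true)) x)) Ω := fun w hw =>
        ((integrable_mul_smoothCell hf (hcell' w hw) m).const_mul _).integrableOn
      refine Eq.trans ?_ (integral_finsetSum S fun w hw => (i1 w hw).sub (i2 w hw)).symm
      refine Finset.sum_congr rfl fun w hw => ?_
      rw [integral_sub' (i1 w hw) (i2 w hw), integral_const_mul, integral_const_mul]
      ring
    · intro x
      rw [hφ, norm_smul, PiLp.norm_single, norm_one, mul_one, Real.norm_eq_abs]
      calc |g x| ≤ ∑ w ∈ S, |s w / 2 * bump m n i w x| := Finset.abs_sum_le_sum_abs _ _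
        _ ≤ ∑ w ∈ S, 1 / 2 * |bump m n i w x| := by
            refine Finset.sum_le_sum fun w _ => ?_
            rw [abs_mul, abs_div, abs_two]
            gcongr
            exact hs1 w
        _ ≤ 1 := by
            rw [← Finset.mul_sum]
            linarith [sum_abs_bump_le m n i S x]
  have lim : Tendsto (fun m : ℕ => ∑ w ∈ S, s w * ((2 * (2 : ℝ) ^ n)⁻¹ *
      ((∫ x in Ω, f x * smoothCell m n w x) -
      ∫ x in Ω, f x * smoothCell m n (nb w (i, true)) x))) atTop (𝓝 (∑ w ∈ S, s w *
      ((2 * (2 : ℝ) ^ n)⁻¹ * ((∫ x in cell n w, f x) - ∫ x in cell n (nb w (i, true)), f x)))) :=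
    tendsto_finsetSum _ fun w hw => (((tendsto_integral_mul_smoothCell hΩ hf (hcell w hw)).sub
      (tendsto_integral_mul_smoothCell hΩ hf (hcell' w hw))).const_mul _).const_mul _
  have h1 := le_of_tendsto' lim key
  have h2 : ∑ w ∈ S, s w * ((2 * (2 : ℝ) ^ n)⁻¹ * ((∫ x in cell n w, f x) -
      ∫ x in cell n (nb w (i, true)), f x)) = (2 * (2 : ℝ) ^ n)⁻¹ * (((2 : ℝ) ^ n) ^ d *
      ∑ w ∈ S, |mean f n w - mean f n (nb w (i, true))|) := by
    rw [Finset.mul_sum, Finset.mul_sum]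
    refine Finset.sum_congr rfl fun w _ => ?_
    rw [integral_cell_eq, integral_cell_eq, ← sign_mul_self (mean f n w - _)]
    simp only [hs]
    ring
  rw [h2, inv_mul_le_iff₀ (by positivity)] at h1
  exact h1

lemma tv_mean_le (hΩ : MeasurableSet Ω) (hf : MemL1TildeLoc Ω f) (hv : var Ω f < ∞) (n : ℤ)
    (L : ℕ) : ((2 : ℝ) ^ n) ^ d * (grid Ω n L).tv (mean f n) ≤
      2 * d * 2 ^ n * (var Ω f).toReal := by
  classical
  rw [tv_grid_eq, Finset.mul_sum]
  calc _ ≤ ∑ i : Fin d, 2 * 2 ^ n * (var Ω f).toReal := by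
        refine Finset.sum_le_sum fun i _ => ?_
        rw [← Finset.sum_filter]
        exact sum_abs_mean_sub_le hΩ hf hv n i _ fun w hw => (Finset.mem_filter.1 hw).2.2.2
    _ = _ := by
        rw [Finset.sum_const, Finset.card_univ, Fintype.card_fin, nsmul_eq_mul]
        ring

end

section

/-- The divergence theorem on a dyadic cube. -/
lemma exists_flux {k : ℕ} {φ : Ed (k + 1) → Ed (k + 1)} (hφ : ContDiff ℝ 1 φ) (h1 : ∀ x, ‖φ x‖ ≤ 1)
    (n : ℤ) : ∃ F : Fin (k + 1) → (Fin (k + 1) → ℤ) → ℝ,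
      (∀ i z, |F i z| ≤ ((2 : ℝ) ^ n) ^ k) ∧
      (∀ i z, F i z ≠ 0 → ∃ x, φ x ≠ 0 ∧
        (∀ j, x j ∈ Set.Icc ((2 : ℝ) ^ n * z j) ((2 : ℝ) ^ n * (z j + 1))) ∧
        ∀ j, x j ∈ Set.Icc ((2 : ℝ) ^ n * nb z (i, false) j)
          ((2 : ℝ) ^ n * (nb z (i, false) j + 1))) ∧
      ∀ z, ∫ x in cell n z, divergence φ x = ∑ i, (F i (nb z (i, true)) - F i z) := by
  have hp := two_zpow_pos n
  let a : (Fin (k + 1) → ℤ) → Fin (k + 1) → ℝ := fun z j => 2 ^ n * z j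
  let b : (Fin (k + 1) → ℤ) → Fin (k + 1) → ℝ := fun z j => 2 ^ n * (z j + 1)
  have hab : ∀ z, a z ≤ b z := fun z j => by
    simp only [a, b]
    gcongr
    linarith
  let f : Fin (k + 1) → (Fin (k + 1) → ℝ) → ℝ := fun i y => φ (WithLp.toLp 2 y) i
  have hle : ∀ x i, |φ x i| ≤ 1 := fun x i => by
    have := PiLp.norm_apply_le (φ x) i
    rw [Real.norm_eq_abs] at this
    exact this.trans (h1 x)
  let F : Fin (k + 1) → (Fin (k + 1) → ℤ) → ℝ := fun i z =>
    ∫ y in Set.Icc (a z ∘ i.succAbove) (b z ∘ i.succAbove), f i (i.insertNth (2 ^ n * z i) y)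
  refine ⟨F, fun i z => ?_, fun i z hF => ?_, fun z => ?_⟩
  · have hvol : volume.real (Set.Icc (a z ∘ i.succAbove) (b z ∘ i.succAbove)) =
        ((2 : ℝ) ^ n) ^ k := by
      have e : ∀ j, b z j - a z j = 2 ^ n := fun j => by simp only [a, b]; ring
      have hle' : a z ∘ i.succAbove ≤ b z ∘ i.succAbove := fun j => hab z (i.succAbove j)
      refine (Real.volume_Icc_pi_toReal hle').trans ?_
      simp [e]
    have := norm_setIntegral_le_of_norm_le_const (μ := volume) (C := 1)
      (s := Set.Icc (a z ∘ i.succAbove) (b z ∘ i.succAbove))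
      (f := fun y => f i (i.insertNth ((2 : ℝ) ^ n * z i) y))
      (isCompact_Icc.measure_lt_top) fun y _ => hle _ _
    rwa [one_mul, hvol] at this
  · obtain ⟨y, hy, hne⟩ : ∃ y ∈ Set.Icc (a z ∘ i.succAbove) (b z ∘ i.succAbove),
        f i (i.insertNth ((2 : ℝ) ^ n * z i) y) ≠ 0 := by
      by_contra! h
      exact hF (setIntegral_eq_zero_of_forall_eq_zero h)
    refine ⟨WithLp.toLp 2 (i.insertNth ((2 : ℝ) ^ n * z i) y), fun h => hne ?_, fun j => ?_,
      fun j => ?_⟩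
    · simp only [f]
      rw [h]
      rfl
    · rcases Fin.eq_self_or_eq_succAbove i j with rfl | ⟨j, rfl⟩
      · simp only [Fin.insertNth_apply_same, Set.mem_Icc]
        constructor <;> nlinarith
      · simp only [Fin.insertNth_apply_succAbove]
        exact ⟨hy.1 j, hy.2 j⟩
    · rcases Fin.eq_self_or_eq_succAbove i j with rfl | ⟨j, rfl⟩
      · simp only [Fin.insertNth_apply_same, Set.mem_Icc, nb, Function.update_self]
        push_cast
        constructor <;> nlinarith
      · simp only [Fin.insertNth_apply_succAbove, nb,
          Function.update_of_ne (Fin.succAbove_ne i j)]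
        exact ⟨hy.1 j, hy.2 j⟩
  · let f' : Fin (k + 1) → (Fin (k + 1) → ℝ) → (Fin (k + 1) → ℝ) →L[ℝ] ℝ := fun i y =>
      (EuclideanSpace.proj i).comp ((fderiv ℝ φ (WithLp.toLp 2 y)).comp
        (PiLp.continuousLinearEquiv 2 ℝ fun _ : Fin (k + 1) => ℝ).symm.toContinuousLinearMap)
    have hf' : ∀ y, ∑ i, f' i y (Pi.single i 1) = divergence φ (WithLp.toLp 2 y) := fun y => rfl
    have hder : ∀ y i, HasFDerivAt (f i) (f' i y) y := fun y i =>
      (EuclideanSpace.proj i).hasFDerivAt.comp y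
        (((hφ.differentiable one_ne_zero _).hasFDerivAt).comp y
        (PiLp.continuousLinearEquiv 2 ℝ fun _ : Fin (k + 1) => ℝ).symm.hasFDerivAt)
    have hcont : Continuous fun y => divergence φ (WithLp.toLp 2 y) := by
      unfold divergence
      refine continuous_finsetSum _ fun i _ => (EuclideanSpace.proj i).continuous.comp ?_
      exact ((hφ.continuous_fderiv one_ne_zero).comp
        (PiLp.continuousLinearEquiv 2 ℝ fun _ : Fin (k + 1) => ℝ).symm.continuous).clm_apply
          continuous_const
    have key := integral_divergence_of_hasFDerivAt_off_countable' (a z) (b z) (hab z) f f' ∅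
      Set.countable_empty (fun i y _ => (hder y i).continuousAt.continuousWithinAt)
      (fun y _ i => hder y i) (by
        simp_rw [hf']
        exact hcont.continuousOn.integrableOn_compact isCompact_Icc)
    simp_rw [hf'] at key
    have e1 : ∫ x in cell n z, divergence φ x =
        ∫ y in Set.Icc (a z) (b z), divergence φ (WithLp.toLp 2 y) := by
      rw [cell_eq_preimage]
      refine Eq.trans ?_ (setIntegral_congr_set Measure.univ_pi_Ico_ae_eq_Icc)
      exact (PiLp.volume_preserving_ofLp (Fin (k + 1))).setIntegral_preimage_emb
        (MeasurableEquiv.toLp 2 (Fin (k + 1) → ℝ)).symm.measurableEmbedding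
        (fun y => divergence φ (WithLp.toLp 2 y)) _
    rw [e1, key]
    refine Finset.sum_congr rfl fun i _ => ?_
    simp only [F]
    have e2 : a (nb z (i, true)) ∘ i.succAbove = a z ∘ i.succAbove := by
      funext j
      simp [a, nb]
    have e3 : b (nb z (i, true)) ∘ i.succAbove = b z ∘ i.succAbove := by
      funext j
      simp [b, nb]
    have e4 : (2 : ℝ) ^ n * (nb z (i, true) i : ℤ) = b z i := by simp [b, nb]
    rw [e2, e3, e4]

variable {d : ℕ} {Ω : Set (Ed d)} {n : ℤ} {L : ℕ}

/-- The function which is constant on each cube. -/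
def step (Ω : Set (Ed d)) (n : ℤ) (L : ℕ) (A : (Fin d → ℤ) → ℝ) (x : Ed d) : ℝ :=
  ∑ z ∈ cells Ω n L, (cell n z).indicator (fun _ => A z) x

lemma sum_mul_flux_le {h : ℝ} {F : (Fin d → ℤ) → ℝ} (i : Fin d) (hF : ∀ z, |F z| ≤ h)
    (hF' : ∀ z, F z ≠ 0 → z ∈ cells Ω n L ∧ nb z (i, false) ∈ cells Ω n L ∧
      cell n z ∪ cell n (nb z (i, false)) ⊆ Ω) (A : (Fin d → ℤ) → ℝ) :
    ∑ z ∈ cells Ω n L, A z * (F (nb z (i, true)) - F z) ≤ h * ∑ z ∈ cells Ω n L,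
      open scoped Classical in
      if (grid Ω n L).E z (i, true) then |A z - A (nb z (i, true))| else 0 := by
  classical
  have hE : ∀ z, F (nb z (i, true)) ≠ 0 → (grid Ω n L).E z (i, true) := by
    intro z hz
    obtain ⟨h1, h2, h3⟩ := hF' _ hz
    rw [nb_false_nb_true] at h2 h3
    exact ⟨h2, h1, interior_subset.trans (Set.union_comm _ _ ▸ h3)⟩
  have e2 : ∑ z ∈ cells Ω n L, A z * F z =
      ∑ z ∈ cells Ω n L, A (nb z (i, true)) * F (nb z (i, true)) := by
    rw [← Finset.sum_filter_ne_zero,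
      ← Finset.sum_filter_ne_zero (s := cells Ω n L) (f := fun z => A (nb z (i, true)) * _)]
    refine Finset.sum_nbij' (fun z => nb z (i, false)) (fun z => nb z (i, true)) ?_ ?_ ?_ ?_ ?_
    · intro z hz
      rw [Finset.mem_filter] at hz ⊢
      rw [nb_true_nb_false]
      exact ⟨(hF' z (right_ne_zero_of_mul hz.2)).2.1, hz.2⟩
    · intro z hz
      rw [Finset.mem_filter] at hz ⊢
      exact ⟨(hF' _ (right_ne_zero_of_mul hz.2)).1, hz.2⟩
    · exact fun z _ => nb_nb z i false
    · exact fun z _ => nb_nb z i true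
    · intro z _
      rw [nb_true_nb_false]
  simp_rw [mul_sub]
  rw [Finset.sum_sub_distrib, e2, ← Finset.sum_sub_distrib, Finset.mul_sum]
  refine Finset.sum_le_sum fun z _ => ?_
  rw [← sub_mul]
  split_ifs with hz
  · rw [mul_comm h]
    refine (le_abs_self _).trans ?_
    rw [abs_mul]
    exact mul_le_mul_of_nonneg_left (hF _) (abs_nonneg _)
  · rw [not_ne_iff.1 (mt (hE z) hz)]
    simp

lemma continuous_divergence {φ : Ed d → Ed d} (hφ : ContDiff ℝ 1 φ) :
    Continuous (divergence φ) := by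
  unfold divergence
  refine continuous_finsetSum _ fun i _ => (EuclideanSpace.proj i).continuous.comp ?_
  exact (hφ.continuous_fderiv one_ne_zero).clm_apply continuous_const

lemma divergence_eq_zero {φ : Ed d → Ed d} {x : Ed d} (hx : x ∉ tsupport φ) :
    divergence φ x = 0 := by
  rw [divergence, notMem_tsupport_iff_eventuallyEq.1 hx |>.fderiv_eq]
  simp

lemma integral_step_mul (A : (Fin d → ℤ) → ℝ) {g : Ed d → ℝ}
    (hg : Continuous g) : ∫ x in Ω, step Ω n L A x * g x =
      ∑ z ∈ cells Ω n L, A z * ∫ x in cell n z, g x := by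
  have hi : ∀ z, Integrable ((cell n z).indicator fun x => A z * g x) := fun z => by
    rw [integrable_indicator_iff (measurableSet_cell n z)]
    have hb := (isBounded_cell n z).isCompact_closure
    exact ((hg.continuousOn.integrableOn_compact hb).mono_set subset_closure).const_mul _
  have e : ∀ x, step Ω n L A x * g x =
      ∑ z ∈ cells Ω n L, (cell n z).indicator (fun x => A z * g x) x := by
    intro x
    rw [step, Finset.sum_mul]
    exact Finset.sum_congr rfl fun z _ => (Set.indicator_mul_left (cell n z) (fun _ => A z) g).symm
  simp_rw [e]
  rw [integral_finsetSum _ fun z _ => (hi z).integrableOn]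
  refine Finset.sum_congr rfl fun z hz => ?_
  rw [setIntegral_indicator (measurableSet_cell n z), ← integral_const_mul]
  refine setIntegral_congr_set ?_
  have h1 := cell_ae_le (mem_cells.1 hz).2
  filter_upwards [h1] with x hx
  exact propext ⟨fun h => h.2, fun h => ⟨hx h, h⟩⟩

/-- The distributional variation of a step function is bounded by its discrete variation. -/
lemma integral_step_mul_divergence_le (hd : 1 ≤ d) {φ : Ed d → Ed d}
    (hφ : ContDiff ℝ 1 φ) (h1 : ∀ x, ‖φ x‖ ≤ 1)
    (hsupp : ∀ x z, φ x ≠ 0 →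
      (∀ j, x j ∈ Set.Icc ((2 : ℝ) ^ n * z j) ((2 : ℝ) ^ n * (z j + 1))) →
      z ∈ box d L ∧ cell n z ⊆ Ω) (A : (Fin d → ℤ) → ℝ) :
    2 ^ n * ∫ x in Ω, step Ω n L A x * divergence φ x ≤
      ((2 : ℝ) ^ n) ^ d * (grid Ω n L).tv A := by
  obtain ⟨k, rfl⟩ : ∃ k, d = k + 1 := ⟨d - 1, by omega⟩
  have hp := two_zpow_pos n
  obtain ⟨F, hF1, hF2, hF3⟩ := exists_flux hφ h1 n
  rw [integral_step_mul A (continuous_divergence hφ), pow_succ', mul_assoc]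
  refine mul_le_mul_of_nonneg_left ?_ hp.le
  simp_rw [hF3, Finset.mul_sum]
  rw [Finset.sum_comm, tv_grid_eq, Finset.mul_sum]
  refine Finset.sum_le_sum fun i _ => sum_mul_flux_le i (hF1 i) (fun z hz => ?_) A
  obtain ⟨x, hx, hz1, hz2⟩ := hF2 i z hz
  obtain ⟨h1, h2⟩ := hsupp x z hx hz1
  obtain ⟨h3, h4⟩ := hsupp x _ hx hz2
  exact ⟨mem_cells.2 ⟨h1, interior_subset.trans h2⟩, mem_cells.2 ⟨h3, interior_subset.trans h4⟩,
    Set.union_subset h2 h4⟩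

/-- The assumption on `φ` in `integral_step_mul_divergence_le` holds for fine enough grids. -/
lemma eventually_support_cells (hΩ : IsOpen Ω) {φ : Ed d → Ed d} (hc : HasCompactSupport φ)
    (hs : tsupport φ ⊆ Ω) : ∀ᶠ N : ℕ in atTop, ∀ x ∈ tsupport φ, ∀ z : Fin d → ℤ,
      (∀ j, x j ∈ Set.Icc ((2 : ℝ) ^ (-N : ℤ) * z j) ((2 : ℝ) ^ (-N : ℤ) * (z j + 1))) →
      z ∈ box d (2 * N) ∧ cell (-N : ℤ) z ⊆ Ω := by
  obtain ⟨δ, hδ, hδΩ⟩ := hc.isCompact.exists_thickening_subset_open hΩ hs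
  obtain ⟨R, hR⟩ := hc.isCompact.isBounded.exists_norm_le
  have l1 : Tendsto (fun N : ℕ => (d : ℝ) * (2 : ℝ) ^ (-N : ℤ)) atTop (𝓝 0) := by
    have := (tendsto_pow_atTop_nhds_zero_of_lt_one (r := (1 / 2 : ℝ)) (by norm_num)
      (by norm_num)).const_mul (d : ℝ)
    rw [mul_zero] at this
    refine this.congr fun N => ?_
    rw [zpow_neg, zpow_natCast, one_div, inv_pow]
  have l2 : Tendsto (fun N : ℕ => (2 : ℝ) ^ N) atTop atTop :=
    tendsto_pow_atTop_atTop_of_one_lt (by norm_num)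
  filter_upwards [l1.eventually_lt_const hδ, l2.eventually_gt_atTop (R + 1)] with N hN1 hN2
  intro x hxs z hz
  have hp := two_zpow_pos (-N : ℤ)
  constructor
  · rw [mem_box]
    intro i
    have hxi : |x i| ≤ R := by
      have := PiLp.norm_apply_le x i
      rw [Real.norm_eq_abs] at this
      exact this.trans (hR x hxs)
    obtain ⟨ha, hb⟩ := hz i
    have hq : (0 : ℝ) < 2 ^ N := by positivity
    rw [zpow_neg, zpow_natCast, inv_mul_le_iff₀ hq] at ha
    rw [zpow_neg, zpow_natCast, le_inv_mul_iff₀ hq] at hb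
    have hq1 : (1 : ℝ) ≤ 2 ^ N := one_le_pow₀ (by norm_num)
    have h3 := abs_le.1 hxi
    constructor
    · have : (-2 ^ (2 * N) : ℝ) ≤ z i := by
        rw [two_mul, pow_add]
        nlinarith
      exact_mod_cast this
    · have : (z i : ℝ) < 2 ^ (2 * N) := by
        rw [two_mul, pow_add]
        nlinarith
      exact_mod_cast this
  · intro y hy
    refine hδΩ (mem_thickening_iff.2 ⟨x, hxs, lt_of_le_of_lt ?_ hN1⟩)
    rw [dist_eq_norm]
    refine norm_le_of_forall_abs_le fun j => ?_
    obtain ⟨h1, h2⟩ := hy j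
    obtain ⟨h3, h4⟩ := hz j
    rw [PiLp.sub_apply, abs_le]
    constructor <;> linarith

end

section

variable {d : ℕ} {Ω : Set (Ed d)} {f : Ed d → ℝ}

lemma tendsto_two_zpow_neg : Tendsto (fun N : ℕ => (2 : ℝ) ^ (-N : ℤ)) atTop (𝓝 0) := by
  refine (tendsto_pow_atTop_nhds_zero_of_lt_one (r := (1 / 2 : ℝ)) (by norm_num)
    (by norm_num)).congr fun N => ?_
  rw [zpow_neg, zpow_natCast, one_div, inv_pow]

lemma eventually_cell_subset (hΩ : IsOpen Ω) {x : Ed d} (hx : x ∈ Ω) :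
    ∀ᶠ N : ℕ in atTop, cell (-N : ℤ) (idx (-N : ℤ) x) ⊆ Ω := by
  obtain ⟨δ, hδ, hb⟩ := Metric.isOpen_iff.1 hΩ x hx
  have l1 := tendsto_two_zpow_neg.const_mul (d : ℝ)
  rw [mul_zero] at l1
  filter_upwards [l1.eventually_lt_const hδ] with N hN y hy
  exact hb ((dist_le_of_mem_cell hy (mem_cell_idx _ x)).trans_lt hN)

lemma mean_eq_average_closedBall (n : ℤ) (z : Fin d → ℤ) : mean f n z =
    ⨍ y in closedBall (fun i => (2 : ℝ) ^ n * (z i + 1 / 2)) (2 ^ n / 2), f (WithLp.toLp 2 y) := by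
  have hp := two_zpow_pos n
  have e : closedBall (fun i => (2 : ℝ) ^ n * (z i + 1 / 2)) ((2 : ℝ) ^ n / 2) =
      Set.Icc (fun i => (2 : ℝ) ^ n * z i) (fun i => (2 : ℝ) ^ n * (z i + 1)) := by
    rw [closedBall_pi _ (by positivity), ← Set.pi_univ_Icc]
    congr 1
    funext i
    rw [Real.closedBall_eq_Icc]
    congr 1 <;> ring
  have e1 : ∫ x in cell n z, f x = ∫ y in Set.Icc (fun i => (2 : ℝ) ^ n * z i)
      (fun i => (2 : ℝ) ^ n * (z i + 1)), f (WithLp.toLp 2 y) := by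
    rw [cell_eq_preimage]
    refine Eq.trans ?_ (setIntegral_congr_set Measure.univ_pi_Ico_ae_eq_Icc)
    exact (PiLp.volume_preserving_ofLp (Fin d)).setIntegral_preimage_emb
      (MeasurableEquiv.toLp 2 (Fin d → ℝ)).symm.measurableEmbedding
      (fun y => f (WithLp.toLp 2 y)) _
  have e2 : volume.real (Set.Icc (fun i => (2 : ℝ) ^ n * z i)
      (fun i => (2 : ℝ) ^ n * (z i + 1))) = ((2 : ℝ) ^ n) ^ d := by
    refine (Real.volume_Icc_pi_toReal fun i => ?_).trans ?_
    · gcongr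
      linarith
    · have : ∀ i, (2 : ℝ) ^ n * (z i + 1) - 2 ^ n * z i = 2 ^ n := fun i => by ring
      simp [this]
  rw [mean_eq, e, setAverage_eq, e1, e2, smul_eq_mul]

lemma ae_tendsto_mean_of_integrable (hf : Integrable f) :
    ∀ᵐ x, Tendsto (fun N : ℕ => mean f (-N : ℤ) (idx (-N : ℤ) x)) atTop (𝓝 (f x)) := by
  have hmp := PiLp.volume_preserving_toLp (Fin d)
  have hg : Integrable fun y => f (WithLp.toLp 2 y) := hmp.integrable_comp_of_integrable hf
  have h1 := IsUnifLocDoublingMeasure.ae_tendsto_average volume hg.locallyIntegrable 1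
  have h2 := (PiLp.volume_preserving_ofLp (Fin d)).quasiMeasurePreserving.ae h1
  filter_upwards [h2] with x hx
  simp_rw [mean_eq_average_closedBall]
  refine hx _ _ ?_ (Eventually.of_forall fun N => ?_)
  · rw [tendsto_nhdsWithin_iff]
    refine ⟨?_, Eventually.of_forall fun N => ?_⟩
    · simpa using tendsto_two_zpow_neg.div_const 2
    · exact half_pos (two_zpow_pos _)
  · have hp := two_zpow_pos (-N : ℤ)
    rw [one_mul, closedBall_pi _ (by positivity)]
    intro i _
    obtain ⟨h1, h2⟩ := mem_cell_idx (-N : ℤ) x i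
    beta_reduce
    rw [Real.closedBall_eq_Icc]
    constructor <;> linarith

lemma mean_congr {g : Ed d → ℝ} {n : ℤ} {z : Fin d → ℤ} (h : Set.EqOn f g (cell n z)) :
    mean f n z = mean g n z := by
  rw [mean_eq, mean_eq, setIntegral_congr_fun (measurableSet_cell n z) h]

/-- Lebesgue differentiation along dyadic cubes. -/
lemma ae_tendsto_mean (hΩ : IsOpen Ω) (hf : MemL1TildeLoc Ω f) :
    ∀ᵐ x, x ∈ Ω → Tendsto (fun N : ℕ => mean f (-N : ℤ) (idx (-N : ℤ) x)) atTop (𝓝 (f x)) := by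
  have h : ∀ R : ℕ, ∀ᵐ x, x ∈ Ω ∩ ball 0 R →
      Tendsto (fun N : ℕ => mean f (-N : ℤ) (idx (-N : ℤ) x)) atTop (𝓝 (f x)) := by
    intro R
    have ho : IsOpen (Ω ∩ ball 0 R) := hΩ.inter isOpen_ball
    have hi : Integrable ((Ω ∩ ball 0 R).indicator f) :=
      (integrable_indicator_iff ho.measurableSet).2
        (hf _ Set.inter_subset_left (isBounded_ball.subset Set.inter_subset_right) ho.measurableSet)
    filter_upwards [ae_tendsto_mean_of_integrable hi] with x hx hxm
    rw [Set.indicator_of_mem hxm] at hx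
    refine hx.congr' ?_
    filter_upwards [eventually_cell_subset ho hxm] with N hN
    exact mean_congr fun y hy => Set.indicator_of_mem (hN hy) f
  filter_upwards [ae_all_iff.2 h] with x hx hxΩ
  obtain ⟨R, hR⟩ := exists_nat_gt ‖x‖
  exact hx R ⟨hxΩ, by simpa using hR⟩

end

section

variable {d : ℕ} {Ω : Set (Ed d)} {f : Ed d → ℝ} {n : ℤ} {L : ℕ}

/-- The means of `f` over the dyadic cubes which contain `x` and whose interior is contained
in `Ω`. -/
def means (Ω : Set (Ed d)) (f : Ed d → ℝ) (x : Ed d) : Set ℝ :=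
  {y | ∃ m : ℤ, interior (cell m (idx m x)) ⊆ Ω ∧ y = mean f m (idx m x)}

lemma dyadicMaxFunInt_eq (x : Ed d) : dyadicMaxFunInt Ω f x = sSup (means Ω f x) := by
  rw [dyadicMaxFunInt]
  congr 1
  ext y
  constructor
  · rintro ⟨Q, ⟨m, z, rfl⟩, hx, hQ, rfl⟩
    obtain rfl := mem_cell.1 hx
    exact ⟨m, hQ, rfl⟩
  · rintro ⟨m, hm, rfl⟩
    exact ⟨cell m (idx m x), ⟨m, idx m x, rfl⟩, mem_cell_idx m x, hm, rfl⟩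

lemma step_of_mem {A : (Fin d → ℤ) → ℝ} {x : Ed d} (hx : idx n x ∈ cells Ω n L) :
    step Ω n L A x = A (idx n x) := by
  rw [step, Finset.sum_eq_single_of_mem (idx n x) hx fun z _ hz =>
    Set.indicator_of_notMem (fun h => hz (mem_cell.1 h).symm) _,
    Set.indicator_of_mem (mem_cell_idx n x)]

lemma measurable_step (A : (Fin d → ℤ) → ℝ) : Measurable (step Ω n L A) := by
  unfold step
  exact Finset.measurable_fun_sum _ fun z _ =>
    measurable_const.indicator (measurableSet_cell n z)

lemma integrable_indicator_cell (n : ℤ) (z : Fin d → ℤ) (c : ℝ) :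
    Integrable ((cell n z).indicator fun _ => c) := by
  rw [integrable_indicator_iff (measurableSet_cell n z)]
  exact integrableOn_const (by rw [volume_cell]; exact ENNReal.ofReal_ne_top)

lemma integrable_step (A : (Fin d → ℤ) → ℝ) : Integrable (step Ω n L A) := by
  unfold step
  exact integrable_finsetSum _ fun z _ => integrable_indicator_cell n z _

lemma integral_step (A : (Fin d → ℤ) → ℝ) :
    ∫ x, step Ω n L A x = ((2 : ℝ) ^ n) ^ d * ∑ z ∈ cells Ω n L, A z := by
  unfold step
  rw [integral_finsetSum _ fun z _ => integrable_indicator_cell n z _, Finset.mul_sum]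
  refine Finset.sum_congr rfl fun z _ => ?_
  rw [integral_indicator_const _ (measurableSet_cell n z), volume_real_cell, smul_eq_mul]

lemma step_nonneg {A : (Fin d → ℤ) → ℝ} (hA : ∀ z ∈ cells Ω n L, 0 ≤ A z) (x : Ed d) :
    0 ≤ step Ω n L A x :=
  Finset.sum_nonneg fun z hz => Set.indicator_nonneg (fun _ _ => hA z hz) x

lemma idx_mem_box {x : Ed d} (h : ∀ i, -(2 : ℝ) ^ (n + L) ≤ x i ∧ x i < (2 : ℝ) ^ (n + L)) :
    idx n x ∈ box d L := by
  rw [mem_box]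
  intro i
  obtain ⟨h1, h2⟩ := h i
  have hp := two_zpow_pos n
  rw [zpow_add₀ (by norm_num), zpow_natCast, mul_comm] at h1 h2
  constructor
  · rw [idx, Int.le_floor, le_div_iff₀ hp]
    push_cast
    linarith
  · rw [idx, Int.floor_lt, div_lt_iff₀ hp]
    push_cast
    exact h2

lemma mean_le_maxFun_of_le (hf : MemL1TildeLoc Ω f) {x : Ed d} (hx : idx n x ∈ cells Ω n L)
    {m : ℤ} (h1 : n ≤ m) (h2 : m ≤ n + L) (h : interior (cell m (idx m x)) ⊆ Ω) :
    mean f m (idx m x) ≤ (grid Ω n L).maxFun (mean f n) (idx n x) := by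
  obtain ⟨k, rfl⟩ : ∃ k : ℕ, m = n + k := ⟨(m - n).toNat, by omega⟩
  rw [idx_add] at h ⊢
  exact mean_le_maxFun hf hx (by omega) h

lemma maxFun_mem_means (hf : MemL1TildeLoc Ω f) {x : Ed d} (hx : idx n x ∈ cells Ω n L) :
    (grid Ω n L).maxFun (mean f n) (idx n x) ∈ means Ω f x := by
  obtain ⟨k, -, h1, h2⟩ := exists_maxFun_eq hf hx
  rw [← idx_add] at h1 h2
  exact ⟨n + k, h1, h2⟩

/-- Means over large cubes are controlled by means over cubes of a fixed scale. -/
lemma mean_le_mean_add (hΩ : MeasurableSet Ω) (hf : MemL1TildeLoc Ω f) (hv : var Ω f < ∞) (x : Ed d)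
    {m : ℤ} (hm : n ≤ m) (h : interior (cell m (idx m x)) ⊆ Ω) :
    mean f m (idx m x) ≤ mean f n (idx n x) +
      (((2 : ℝ) ^ n) ^ d)⁻¹ * (2 * d * 2 ^ n * (var Ω f).toReal) := by
  obtain ⟨k, rfl⟩ : ∃ k : ℕ, m = n + k := ⟨(m - n).toNat, by omega⟩
  rw [idx_add] at h ⊢
  obtain ⟨L, hkL, hL⟩ : ∃ L, k ≤ L ∧ idx n x ∈ box d L := by
    refine ⟨k + ∑ i, (idx n x i).natAbs, Nat.le_add_right _ _, mem_box.2 fun i => ?_⟩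
    have h1 : (idx n x i).natAbs ≤ k + ∑ i, (idx n x i).natAbs :=
      (Finset.single_le_sum (f := fun i => (idx n x i).natAbs) (fun _ _ => Nat.zero_le _)
        (Finset.mem_univ i)).trans (Nat.le_add_left _ _)
    have h2 : ((idx n x i).natAbs : ℤ) < 2 ^ (k + ∑ i, (idx n x i).natAbs) := by
      exact_mod_cast h1.trans_lt Nat.lt_two_pow_self
    omega
  have hcell : idx n x ∈ cells Ω n L :=
    mem_cells.2 ⟨hL, (interior_mono (cell_subset_up n k (idx n x))).trans h⟩
  have h1 := Grid.avg_sub_le (G := grid Ω n L) hcell ((le_height_iff hcell).2 ⟨hkL, h⟩) (mean f n)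
  rw [avg_mean (hf.integrableOn_cell h), tv_grid_neg] at h1
  have h2 : (grid Ω n L).tv (mean f n) ≤
      (((2 : ℝ) ^ n) ^ d)⁻¹ * (2 * d * 2 ^ n * (var Ω f).toReal) := by
    have hp := two_zpow_pos n
    rw [le_inv_mul_iff₀ (by positivity)]
    exact tv_mean_le hΩ hf hv n L
  linarith

/-- The integral of the maximal function over cubes in a bounded region. -/
lemma integral_step_maxFun_sub_le (hΩ : MeasurableSet Ω) (hf : MemL1TildeLoc Ω f)
    (hv : var Ω f < ∞) :
    ∫ x, step Ω n L (fun z => (grid Ω n L).maxFun (mean f n) z - mean f n z) x ≤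
      const d * 2 ^ L * (2 * d * 2 ^ n * (var Ω f).toReal) := by
  have hc := const_pos (d := d)
  rw [integral_step]
  calc _ ≤ ((2 : ℝ) ^ n) ^ d * (const d * 2 ^ L * (grid Ω n L).tv (mean f n)) := by
        have hp := two_zpow_pos n
        exact mul_le_mul_of_nonneg_left ((grid Ω n L).sum_maxFun_sub_le (mean f n)) (by positivity)
    _ = const d * 2 ^ L * (((2 : ℝ) ^ n) ^ d * (grid Ω n L).tv (mean f n)) := by ring
    _ ≤ _ := mul_le_mul_of_nonneg_left (tv_mean_le hΩ hf hv n L) (by positivity)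

lemma eventually_idx_mem_cells (hΩ : IsOpen Ω) {x : Ed d} (hx : x ∈ Ω) {n₀ : ℕ}
    (hb : ∀ i, -(2 : ℝ) ^ n₀ ≤ x i ∧ x i < (2 : ℝ) ^ n₀) :
    ∀ᶠ N : ℕ in atTop, idx (-N : ℤ) x ∈ cells Ω (-N : ℤ) (n₀ + N) := by
  filter_upwards [eventually_cell_subset hΩ hx] with N hN
  refine mem_cells.2 ⟨idx_mem_box fun i => ?_, interior_subset.trans hN⟩
  have : (-(N : ℤ) + ((n₀ + N : ℕ) : ℤ)) = (n₀ : ℤ) := by push_cast; ring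
  rw [this, zpow_natCast]
  exact hb i

/-- A pointwise bound for the maximal function on bounded sets. -/
lemma exists_bound_means (hΩ : IsOpen Ω) (hf : MemL1TildeLoc Ω f) (hv : var Ω f < ∞) (n₀ : ℕ) :
    ∃ (G : Ed d → ℝ) (c : ℝ), Integrable G ∧ (∀ x, 0 ≤ G x) ∧ 0 ≤ c ∧
      ∀ᵐ x, x ∈ Ω → (∀ i, -(2 : ℝ) ^ n₀ ≤ x i ∧ x i < (2 : ℝ) ^ n₀) →
      ∀ y ∈ means Ω f x, y ≤ f x + G x + c := by
  set h : ℕ → Ed d → ℝ := fun N => step Ω (-N : ℤ) (n₀ + N) fun z =>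
    (grid Ω (-N : ℤ) (n₀ + N)).maxFun (mean f (-N : ℤ)) z - mean f (-N : ℤ) z with hh
  have hpos : ∀ N x, 0 ≤ h N x := fun N x =>
    step_nonneg (fun z _ => sub_nonneg.2 (Grid.le_maxFun _ _)) x
  set K : ℝ := const d * 2 ^ n₀ * (2 * d * (var Ω f).toReal)
  have hfi : ∀ N, ∫⁻ x, ENNReal.ofReal (h N x) ≤ ENNReal.ofReal K := by
    intro N
    rw [← ofReal_integral_eq_lintegral_ofReal (integrable_step _) (Eventually.of_forall (hpos N))]
    refine ENNReal.ofReal_le_ofReal ((integral_step_maxFun_sub_le hΩ.measurableSet hf hv).trans_eq ?_)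
    have : (2 : ℝ) ^ (-N : ℤ) * 2 ^ N = 1 := by
      rw [zpow_neg, zpow_natCast, inv_mul_cancel₀ (by positivity)]
    rw [pow_add]
    linear_combination (const d * 2 ^ n₀ * (2 * d * (var Ω f).toReal)) * this
  set ℓ : Ed d → ℝ≥0∞ := fun x => liminf (fun N => ENNReal.ofReal (h N x)) atTop with hℓ
  have hm : ∀ N, Measurable fun x => ENNReal.ofReal (h N x) := fun N =>
    (measurable_step _).ennreal_ofReal
  have hℓm : Measurable ℓ := Measurable.liminf hm
  have hℓi : ∫⁻ x, ℓ x ≠ ∞ := by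
    refine ne_top_of_le_ne_top (ENNReal.ofReal_ne_top (r := K)) ((lintegral_liminf_le hm).trans ?_)
    exact liminf_le_of_le (by isBoundedDefault) fun b hb => by
      obtain ⟨N, hN⟩ := hb.exists
      exact hN.trans (hfi N)
  have hp := two_zpow_pos n₀
  refine ⟨fun x => (ℓ x).toReal, (((2 : ℝ) ^ (n₀ : ℤ)) ^ d)⁻¹ *
    (2 * d * 2 ^ (n₀ : ℤ) * (var Ω f).toReal), integrable_toReal_of_lintegral_ne_top
    hℓm.aemeasurable hℓi, fun x => ENNReal.toReal_nonneg, by positivity, ?_⟩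
  filter_upwards [ae_lt_top hℓm hℓi, ae_tendsto_mean hΩ hf] with x hx1 hx2 hxΩ hb y hy
  have hsmall : ∀ m : ℤ, m ≤ n₀ → interior (cell m (idx m x)) ⊆ Ω →
      mean f m (idx m x) ≤ f x + (ℓ x).toReal := by
    intro m hm0 hm
    have h1 : Tendsto (fun N : ℕ => ENNReal.ofReal (mean f m (idx m x) -
        mean f (-N : ℤ) (idx (-N : ℤ) x))) atTop
        (𝓝 (ENNReal.ofReal (mean f m (idx m x) - f x))) :=
      ENNReal.tendsto_ofReal ((hx2 hxΩ).const_sub _)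
    have h2 : ENNReal.ofReal (mean f m (idx m x) - f x) ≤ ℓ x := by
      rw [← h1.liminf_eq]
      refine liminf_le_liminf ?_
      filter_upwards [eventually_idx_mem_cells hΩ hxΩ hb, eventually_ge_atTop (-m).toNat]
        with N hN1 hN2
      refine ENNReal.ofReal_le_ofReal ?_
      simp only [hh]
      rw [step_of_mem hN1]
      refine sub_le_sub_right (mean_le_maxFun_of_le hf hN1 (by omega) ?_ hm) _
      push_cast
      omega
    rw [ENNReal.ofReal_le_iff_le_toReal hx1.ne] at h2
    linarith
  have hc : 0 ≤ (((2 : ℝ) ^ (n₀ : ℤ)) ^ d)⁻¹ * (2 * d * 2 ^ (n₀ : ℤ) * (var Ω f).toReal) := by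
    positivity
  obtain ⟨m, hm, rfl⟩ := hy
  rcases le_total m n₀ with hmn | hmn
  · linarith [hsmall m hmn hm]
  · have h1 := mean_le_mean_add hΩ.measurableSet hf hv x hmn hm
    have h2 : interior (cell (n₀ : ℤ) (idx n₀ x)) ⊆ Ω := by
      refine (interior_mono ?_).trans hm
      obtain ⟨k, rfl⟩ : ∃ k : ℕ, m = n₀ + k := ⟨(m - n₀).toNat, by omega⟩
      rw [idx_add]
      exact cell_subset_up _ _ _
    linarith [hsmall n₀ le_rfl h2]

lemma exists_forall_abs_lt (R : ℝ) : ∃ n₀ : ℕ, ∀ x : Ed d, ‖x‖ ≤ R →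
    ∀ i, -(2 : ℝ) ^ n₀ ≤ x i ∧ x i < (2 : ℝ) ^ n₀ := by
  obtain ⟨n₀, hn₀⟩ := pow_unbounded_of_one_lt R (one_lt_two (α := ℝ))
  refine ⟨n₀, fun x hx i => ?_⟩
  have h1 := PiLp.norm_apply_le x i
  rw [Real.norm_eq_abs] at h1
  have h2 := abs_le.1 (h1.trans hx)
  constructor <;> linarith

lemma ae_bddAbove_means (hΩ : IsOpen Ω) (hf : MemL1TildeLoc Ω f) (hv : var Ω f < ∞) :
    ∀ᵐ x, x ∈ Ω → BddAbove (means Ω f x) := by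
  have h : ∀ n₀ : ℕ, ∀ᵐ x : Ed d, x ∈ Ω → (∀ i, -(2 : ℝ) ^ n₀ ≤ x i ∧ x i < (2 : ℝ) ^ n₀) →
      BddAbove (means Ω f x) := by
    intro n₀
    obtain ⟨G, c, -, -, -, h⟩ := exists_bound_means hΩ hf hv n₀
    filter_upwards [h] with x hx hxΩ hb
    exact ⟨_, fun y hy => hx hxΩ hb y hy⟩
  filter_upwards [ae_all_iff.2 h] with x hx hxΩ
  obtain ⟨n₀, hn₀⟩ := exists_forall_abs_lt (d := d) ‖x‖
  exact hx n₀ hxΩ (hn₀ x le_rfl)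

/-- Discrete maximal functions converge to the maximal function. -/
lemma tendsto_step_maxFun (hΩ : IsOpen Ω) (hf : MemL1TildeLoc Ω f) {x : Ed d} (hx : x ∈ Ω)
    (hb : BddAbove (means Ω f x)) :
    Tendsto (fun N : ℕ => step Ω (-N : ℤ) (2 * N) ((grid Ω (-N : ℤ) (2 * N)).maxFun
      (mean f (-N : ℤ))) x) atTop (𝓝 (dyadicMaxFunInt Ω f x)) := by
  rw [dyadicMaxFunInt_eq]
  obtain ⟨n₀, hn₀⟩ := exists_forall_abs_lt (d := d) ‖x‖
  have hev : ∀ᶠ N : ℕ in atTop, idx (-N : ℤ) x ∈ cells Ω (-N : ℤ) (2 * N) := by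
    filter_upwards [eventually_cell_subset hΩ hx, eventually_ge_atTop n₀] with N hN hN0
    refine mem_cells.2 ⟨idx_mem_box fun i => ?_, interior_subset.trans hN⟩
    have : (-(N : ℤ) + ((2 * N : ℕ) : ℤ)) = (N : ℤ) := by push_cast; ring
    rw [this, zpow_natCast]
    have h1 := hn₀ x le_rfl i
    have h2 : (2 : ℝ) ^ n₀ ≤ 2 ^ N := pow_le_pow_right₀ (by norm_num) hN0
    constructor <;> linarith
  have hne : (means Ω f x).Nonempty := by
    obtain ⟨N, hN⟩ := hev.exists
    exact ⟨_, maxFun_mem_means hf hN⟩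
  rw [tendsto_order]
  constructor
  · intro a ha
    obtain ⟨y, ⟨m, hm, rfl⟩, hay⟩ := exists_lt_of_lt_csSup hne ha
    filter_upwards [hev, eventually_ge_atTop m.natAbs] with N hN hNm
    rw [step_of_mem hN]
    refine hay.trans_le (mean_le_maxFun_of_le hf hN (by omega) ?_ hm)
    push_cast
    omega
  · intro a ha
    filter_upwards [hev] with N hN
    rw [step_of_mem hN]
    exact (le_csSup hb (maxFun_mem_means hf hN)).trans_lt ha

lemma ae_le_dyadicMaxFunInt (hΩ : IsOpen Ω) (hf : MemL1TildeLoc Ω f) (hv : var Ω f < ∞) :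
    ∀ᵐ x, x ∈ Ω → f x ≤ dyadicMaxFunInt Ω f x := by
  filter_upwards [ae_tendsto_mean hΩ hf, ae_bddAbove_means hΩ hf hv] with x h1 h2 hx
  refine le_of_tendsto (h1 hx) ?_
  filter_upwards [eventually_cell_subset hΩ hx] with N hN
  rw [dyadicMaxFunInt_eq]
  exact le_csSup (h2 hx) ⟨-N, interior_subset.trans hN, rfl⟩

lemma ae_tendsto_step_maxFun (hΩ : IsOpen Ω) (hf : MemL1TildeLoc Ω f) (hv : var Ω f < ∞) :
    ∀ᵐ x, x ∈ Ω → Tendsto (fun N : ℕ => step Ω (-N : ℤ) (2 * N)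
      ((grid Ω (-N : ℤ) (2 * N)).maxFun (mean f (-N : ℤ))) x) atTop
      (𝓝 (dyadicMaxFunInt Ω f x)) := by
  filter_upwards [ae_bddAbove_means hΩ hf hv] with x h hx
  exact tendsto_step_maxFun hΩ hf hx (h hx)

lemma memL1TildeLoc_dyadicMaxFunInt (hΩ : IsOpen Ω) (hf : MemL1TildeLoc Ω f)
    (hv : var Ω f < ∞) : MemL1TildeLoc Ω (dyadicMaxFunInt Ω f) := by
  intro U hU hb hUm
  obtain ⟨R, hR⟩ := hb.exists_norm_le
  obtain ⟨n₀, hn₀⟩ := exists_forall_abs_lt (d := d) R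
  obtain ⟨G, c, hG, hG0, hc, hbd⟩ := exists_bound_means hΩ hf hv n₀
  have hci : IntegrableOn (fun _ : Ed d => c) U :=
    integrableOn_const hb.measure_lt_top.ne
  have hfi := hf U hU hb hUm
  refine Integrable.mono' ((hfi.norm.add hG.integrableOn).add hci)
    (aestronglyMeasurable_of_tendsto_ae atTop
      (fun N => (measurable_step _).aestronglyMeasurable)
      ((ae_restrict_iff' hUm).2 ((ae_tendsto_step_maxFun hΩ hf hv).mono fun x hx hxU =>
        hx (hU hxU)))) ?_
  rw [ae_restrict_iff' hUm]
  filter_upwards [hbd, ae_le_dyadicMaxFunInt hΩ hf hv] with x h1 h2 hxU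
  have h3 := h2 (hU hxU)
  have hne : (means Ω f x).Nonempty := by
    obtain ⟨N, hN⟩ := (eventually_cell_subset hΩ (hU hxU)).exists
    exact ⟨_, -N, interior_subset.trans hN, rfl⟩
  have h4 : dyadicMaxFunInt Ω f x ≤ f x + G x + c := by
    rw [dyadicMaxFunInt_eq]
    exact csSup_le hne (h1 (hU hxU) (hn₀ x (hR x hxU)))
  have h5 := hG0 x
  have h6 := neg_abs_le (f x)
  have h7 := le_abs_self (f x)
  simp only [Pi.add_apply, Real.norm_eq_abs]
  rw [abs_le]
  constructor <;> linarith

lemma integral_dyadicMaxFunInt_mul_divergence_le (hd : 1 ≤ d) (hΩ : IsOpen Ω)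
    (hf : MemL1TildeLoc Ω f) (hv : var Ω f < ∞) {φ : Ed d → Ed d} (hφ : ContDiff ℝ 1 φ)
    (hc : HasCompactSupport φ) (hs : tsupport φ ⊆ Ω) (h1 : ∀ x, ‖φ x‖ ≤ 1) :
    ∫ x in Ω, dyadicMaxFunInt Ω f x * divergence φ x ≤
      const d * (2 * d) * (var Ω f).toReal := by
  obtain ⟨N₁, hN₁⟩ := eventually_atTop.1 (eventually_support_cells hΩ hc hs)
  have hcells : ∀ N ≥ N₁, ∀ x ∈ tsupport φ, idx (-N : ℤ) x ∈ cells Ω (-N : ℤ) (2 * N) := by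
    intro N hN x hx
    obtain ⟨h2, h3⟩ := hN₁ N hN x hx (idx (-N : ℤ) x) fun j =>
      Set.Ico_subset_Icc_self (mem_cell_idx (-N : ℤ) x j)
    exact mem_cells.2 ⟨h2, interior_subset.trans h3⟩
  have hK : MeasurableSet (tsupport φ) := (isClosed_tsupport φ).measurableSet
  have hrestrict : ∀ g : Ed d → ℝ, ∫ x in Ω, g x * divergence φ x =
      ∫ x in tsupport φ, g x * divergence φ x := fun g =>
    setIntegral_eq_of_subset_of_forall_sdiff_eq_zero hΩ.measurableSet hs fun x hx => by
      rw [divergence_eq_zero hx.2, mul_zero]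
  obtain ⟨B, hB⟩ := hc.isCompact.exists_bound_of_continuousOn
    (continuous_divergence hφ).continuousOn
  have hbound : ∀ N : ℕ, N₁ ≤ N → ∫ x in tsupport φ, step Ω (-N : ℤ) (2 * N)
      ((grid Ω (-N : ℤ) (2 * N)).maxFun (mean f (-N : ℤ))) x * divergence φ x ≤
      const d * (2 * d) * (var Ω f).toReal := by
    intro N hN
    rw [← hrestrict]
    have hp := two_zpow_pos (-N : ℤ)
    have h2 := integral_step_mul_divergence_le hd hφ h1 (Ω := Ω) (n := -N) (L := 2 * N)
      (fun x z hx => hN₁ N hN x (subset_tsupport _ hx) z)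
      ((grid Ω (-N : ℤ) (2 * N)).maxFun (mean f (-N : ℤ)))
    have h3 := (grid Ω (-N : ℤ) (2 * N)).tv_maxFun_le (mean f (-N : ℤ))
    have h4 := mul_le_mul_of_nonneg_left (tv_mean_le hΩ.measurableSet hf hv (-N : ℤ) (2 * N))
      (const_pos (d := d)).le
    have h5 := mul_le_mul_of_nonneg_left h3 (pow_pos hp d).le
    refine le_of_mul_le_mul_left ?_ hp
    linarith
  have hF := memL1TildeLoc_dyadicMaxFunInt hΩ hf hv _ hs hc.isCompact.isBounded hK
  have hlim : Tendsto (fun N : ℕ => ∫ x in tsupport φ, step Ω (-N : ℤ) (2 * N)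
      ((grid Ω (-N : ℤ) (2 * N)).maxFun (mean f (-N : ℤ))) x * divergence φ x) atTop
      (𝓝 (∫ x in tsupport φ, dyadicMaxFunInt Ω f x * divergence φ x)) := by
    refine tendsto_integral_filter_of_dominated_convergence (fun x =>
      (|dyadicMaxFunInt Ω f x| + |step Ω (-N₁ : ℤ) (2 * N₁) (mean f (-N₁ : ℤ)) x|) * B)
      (Eventually.of_forall fun N => ?_) ?_ ?_ ?_
    · exact ((measurable_step _).mul
        (continuous_divergence hφ).measurable).aestronglyMeasurable
    · filter_upwards [eventually_ge_atTop N₁] with N hN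
      rw [ae_restrict_iff' hK]
      filter_upwards [ae_bddAbove_means hΩ hf hv] with x hbd hx
      rw [norm_mul, Real.norm_eq_abs]
      refine mul_le_mul ?_ (hB x hx) (norm_nonneg _) (by positivity)
      rw [step_of_mem (hcells N hN x hx), step_of_mem (hcells N₁ le_rfl x hx)]
      have h2 : (grid Ω (-N : ℤ) (2 * N)).maxFun (mean f (-N : ℤ)) (idx (-N : ℤ) x) ≤
          dyadicMaxFunInt Ω f x := by
        rw [dyadicMaxFunInt_eq]
        exact le_csSup (hbd (hs hx)) (maxFun_mem_means hf (hcells N hN x hx))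
      have h3 : mean f (-N₁ : ℤ) (idx (-N₁ : ℤ) x) ≤
          (grid Ω (-N : ℤ) (2 * N)).maxFun (mean f (-N : ℤ)) (idx (-N : ℤ) x) :=
        mean_le_maxFun_of_le hf (hcells N hN x hx) (by omega) (by push_cast; omega)
          (mem_cells.1 (hcells N₁ le_rfl x hx)).2
      have h4 := le_abs_self (dyadicMaxFunInt Ω f x)
      have h5 := neg_abs_le (mean f (-N₁ : ℤ) (idx (-N₁ : ℤ) x))
      have h6 := abs_nonneg (dyadicMaxFunInt Ω f x)
      have h7 := abs_nonneg (mean f (-N₁ : ℤ) (idx (-N₁ : ℤ) x))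
      rw [abs_le]
      constructor <;> linarith
    · exact (hF.abs.add (integrable_step _).abs.integrableOn).mul_const B
    · rw [ae_restrict_iff' hK]
      filter_upwards [ae_tendsto_step_maxFun hΩ hf hv] with x hx hxK
      exact (hx (hs hxK)).mul_const _
  rw [hrestrict]
  exact le_of_tendsto hlim (eventually_atTop.2 ⟨N₁, hbound⟩)

end

end DyadicGrid

/-- Variation of the interior dyadic local maximal function: there is `C = C_d < ∞` such that
for every open `Ω ⊆ ℝ^d` and every `f ∈ L¹_{~loc}(Ω)` with `var_Ω f < ∞`, also
`M̃_Ω f ∈ L¹_{~loc}(Ω)` and `var_Ω (M̃_Ω f) ≤ C · var_Ω f`. -/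
theorem variation_of_interior_dyadic_maximal_function (d : ℕ) (hd : 1 ≤ d) :
    ∃ C : ℝ≥0∞, C ≠ ∞ ∧
      ∀ (Ω : Set (Ed d)), IsOpen Ω → ∀ f : Ed d → ℝ,
        MemL1TildeLoc Ω f → var Ω f < ∞ →
          MemL1TildeLoc Ω (dyadicMaxFunInt Ω f) ∧
          var Ω (dyadicMaxFunInt Ω f) ≤ C * var Ω f := by
  have hc := DyadicGrid.const_pos (d := d)
  refine ⟨ENNReal.ofReal (DyadicGrid.const d * (2 * d)), ENNReal.ofReal_ne_top,
    fun Ω hΩ f hf hv => ⟨DyadicGrid.memL1TildeLoc_dyadicMaxFunInt hΩ hf hv, ?_⟩⟩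
  refine iSup₂_le fun φ ⟨h1, h2, h3, h4⟩ => ?_
  rw [← ENNReal.ofReal_toReal hv.ne, ← ENNReal.ofReal_mul (by positivity)]
  exact ENNReal.ofReal_le_ofReal
    (DyadicGrid.integral_dyadicMaxFunInt_mul_divergence_le hd hΩ hf hv h1 h2 h3 h4)

end
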